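/- Fix a positive integer b and a nonnegative integer c. There exist a constant c₀ > 0 and an integer N such that for every integer n ≥ N the following negative correlation properties hold: (i) for every real p ≥ c₀ · n · log n, M_p(x₁² x₂²) · M_p(1) ≤ M_p(x₁²) · M_p(x₂²), where M_p is taken with respect to the density f_{2,b,c}(x)·e^{−‖x‖_p^p} on ℝⁿ; (ii) for every p ∈ [c₀ · n · log n, ∞], the same inequality holds for the integrals taken with respect to the density 1_{B_p^n}(x)·f_{2,b,c}(x) on ℝⁿ, where B_p^n is the unit ℓ_p ball (the unit cube [−1,1]ⁿ for p = ∞). -/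

import Mathlib

open MeasureTheory Real

/-- The density `∏_{i<j} |x_i^a - x_j^a|^b · ∏_i |x_i|^c` on `ℝⁿ`. -/
noncomputable def fabc (n a b c : ℕ) (x : Fin n → ℝ) : ℝ :=
  (∏ i : Fin n, ∏ j : Fin n, if i < j then |x i ^ a - x j ^ a| ^ b else 1) *
    ∏ i : Fin n, |x i| ^ c

/-- `M_p(g) = ∫ g(x) f_{a,b,c}(x) exp(-‖x‖_p^p) dx`. -/
noncomputable def Mp (n a b c : ℕ) (p : ℝ) (g : (Fin n → ℝ) → ℝ) : ℝ :=
  ∫ x : Fin n → ℝ, g x * fabc n a b c x * Real.exp (-∑ i, |x i| ^ p)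

/-- Integration against the density `1_{B_p^n} f_{a,b,c}`, where `B_p^n` is the unit `ℓ_p`
ball. -/
noncomputable def MBp (n a b c : ℕ) (p : ℝ) (g : (Fin n → ℝ) → ℝ) : ℝ :=
  ∫ x in {x : Fin n → ℝ | (∑ i, |x i| ^ p) ^ (1 / p) ≤ 1}, g x * fabc n a b c x

/-- Integration against the density `1_{B_∞^n} f_{a,b,c}`, where `B_∞^n = [-1,1]ⁿ`. -/
noncomputable def MBinf (n a b c : ℕ) (g : (Fin n → ℝ) → ℝ) : ℝ :=
  ∫ x in {x : Fin n → ℝ | ∀ i, |x i| ≤ 1}, g x * fabc n a b c x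

namespace S15

open Filter Topology

/-- Product of `1 + |x i|`. -/
noncomputable def Pw {n : ℕ} (x : Fin n → ℝ) : ℝ := ∏ i, (1 + |x i|)

lemma one_le_Pw {n : ℕ} (x : Fin n → ℝ) : 1 ≤ Pw x := by
  unfold Pw
  have : ∏ i : Fin n, (1:ℝ) ≤ ∏ i, (1 + |x i|) :=
    Finset.prod_le_prod (fun _ _ => zero_le_one) (fun i _ => by linarith [abs_nonneg (x i)])
  simpa using this

lemma Pw_pos {n : ℕ} (x : Fin n → ℝ) : 0 < Pw x := lt_of_lt_of_le one_pos (one_le_Pw x)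

lemma one_add_abs_le_Pw {n : ℕ} (x : Fin n → ℝ) (i : Fin n) : 1 + |x i| ≤ Pw x := by
  unfold Pw
  rw [← Finset.mul_prod_erase _ _ (Finset.mem_univ i)]
  have h1 : ∏ j ∈ Finset.univ.erase i, (1:ℝ) ≤ ∏ j ∈ Finset.univ.erase i, (1 + |x j|) :=
    Finset.prod_le_prod (fun _ _ => zero_le_one) (fun i _ => by linarith [abs_nonneg (x i)])
  simp only [Finset.prod_const_one] at h1
  nlinarith [abs_nonneg (x i)]

lemma measurable_Pw {n : ℕ} : Measurable (Pw : (Fin n → ℝ) → ℝ) := by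
  unfold Pw; fun_prop

/-- Measurable with polynomial growth. -/
def Good {n : ℕ} (G : (Fin n → ℝ) → ℝ) : Prop :=
  Measurable G ∧ ∃ (C : ℝ) (K : ℕ), ∀ x, |G x| ≤ C * Pw x ^ K

lemma Good.const {n : ℕ} (a : ℝ) : Good (fun _ : Fin n → ℝ => a) :=
  ⟨measurable_const, |a|, 0, fun x => by simp⟩

lemma bd_nonneg {n : ℕ} {G : (Fin n → ℝ) → ℝ} {C : ℝ} {K : ℕ}
    (h : ∀ x, |G x| ≤ C * Pw x ^ K) : 0 ≤ C := by
  have := (abs_nonneg _).trans (h 0)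
  exact nonneg_of_mul_nonneg_left this (pow_pos (Pw_pos _) _)

lemma Good.add {n : ℕ} {F G : (Fin n → ℝ) → ℝ} (hF : Good F) (hG : Good G) :
    Good (fun x => F x + G x) := by
  obtain ⟨mF, C, K, hF⟩ := hF
  obtain ⟨mG, D, L, hG⟩ := hG
  have hC := bd_nonneg hF
  have hD := bd_nonneg hG
  refine ⟨mF.add mG, C + D, K + L, fun x => (abs_add_le _ _).trans ?_⟩
  rw [add_mul]
  refine add_le_add ((hF x).trans ?_) ((hG x).trans ?_)
  · exact mul_le_mul_of_nonneg_left (pow_le_pow_right₀ (one_le_Pw x) (by omega)) hC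
  · exact mul_le_mul_of_nonneg_left (pow_le_pow_right₀ (one_le_Pw x) (by omega)) hD

lemma Good.mul {n : ℕ} {F G : (Fin n → ℝ) → ℝ} (hF : Good F) (hG : Good G) :
    Good (fun x => F x * G x) := by
  obtain ⟨mF, C, K, hF⟩ := hF
  obtain ⟨mG, D, L, hG⟩ := hG
  have hC := bd_nonneg hF
  refine ⟨mF.mul mG, C * D, K + L, fun x => ?_⟩
  rw [abs_mul, pow_add]
  calc |F x| * |G x| ≤ (C * Pw x ^ K) * (D * Pw x ^ L) :=
        mul_le_mul (hF x) (hG x) (abs_nonneg _) ((abs_nonneg _).trans (hF x))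
    _ = _ := by ring

lemma Good.pow {n : ℕ} {F : (Fin n → ℝ) → ℝ} (hF : Good F) (k : ℕ) :
    Good (fun x => F x ^ k) := by
  induction k with
  | zero => simpa using Good.const 1
  | succ k ih => simpa [pow_succ] using ih.mul hF

lemma Good.neg {n : ℕ} {F : (Fin n → ℝ) → ℝ} (hF : Good F) : Good (fun x => - F x) := by
  simpa using (Good.const (-1)).mul hF

lemma Good.sub {n : ℕ} {F G : (Fin n → ℝ) → ℝ} (hF : Good F) (hG : Good G) :
    Good (fun x => F x - G x) := by
  simpa [sub_eq_add_neg] using hF.add hG.neg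

lemma Good.abs {n : ℕ} {F : (Fin n → ℝ) → ℝ} (hF : Good F) : Good (fun x => |F x|) := by
  obtain ⟨mF, C, K, hF⟩ := hF
  exact ⟨mF.abs, C, K, fun x => by simpa using hF x⟩

lemma Good.of_le {n : ℕ} {F G : (Fin n → ℝ) → ℝ} (hF : Good F) (mG : Measurable G)
    (h : ∀ x, |G x| ≤ F x) : Good G := by
  obtain ⟨mF, C, K, hF⟩ := hF
  exact ⟨mG, C, K, fun x => (h x).trans ((le_abs_self _).trans (hF x))⟩

lemma Good.prod {n : ℕ} {ι : Type*} (s : Finset ι) {F : ι → (Fin n → ℝ) → ℝ}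
    (hF : ∀ i, Good (F i)) : Good (fun x => ∏ i ∈ s, F i x) := by
  classical
  induction s using Finset.induction_on with
  | empty => simpa using Good.const 1
  | insert a s ha ih => simpa [Finset.prod_insert ha] using (hF a).mul ih

lemma Good.coord {n : ℕ} (i : Fin n) : Good (fun x : Fin n → ℝ => x i) :=
  ⟨measurable_pi_apply i, 1, 1, fun x => by
    have := one_add_abs_le_Pw x i
    simp; linarith⟩

lemma Good.rpow {n : ℕ} (i : Fin n) {r : ℝ} (hr : 0 ≤ r) :
    Good (fun x : Fin n → ℝ => |x i| ^ r) := by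
  refine Good.of_le (((Good.const 1).add (Good.coord i).abs).pow ⌈r⌉₊) (by fun_prop) fun x => ?_
  rw [abs_of_nonneg (Real.rpow_nonneg (abs_nonneg _) _)]
  calc |x i| ^ r ≤ (1 + |x i|) ^ r :=
        Real.rpow_le_rpow (abs_nonneg _) (by linarith) hr
    _ ≤ (1 + |x i|) ^ ((⌈r⌉₊ : ℕ) : ℝ) :=
        Real.rpow_le_rpow_of_exponent_le (by linarith [abs_nonneg (x i)]) (Nat.le_ceil r)
    _ = _ := Real.rpow_natCast _ _

lemma continuous_fabc (n b c : ℕ) : Continuous (fabc n 2 b c) := by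
  unfold fabc
  refine Continuous.mul ?_ (by fun_prop)
  refine continuous_finsetProd _ fun i _ => continuous_finsetProd _ fun j _ => ?_
  split_ifs <;> fun_prop

lemma Good.fabc (n b c : ℕ) : Good (fabc n 2 b c) := by
  have : Good (fun x : Fin n → ℝ =>
      (∏ i : Fin n, ∏ j : Fin n, if i < j then |x i ^ 2 - x j ^ 2| ^ b else 1) *
    ∏ i : Fin n, |x i| ^ c) := by
    refine Good.mul (Good.prod _ fun i => Good.prod _ fun j => ?_)
      (Good.prod _ fun i => (Good.coord i).abs.pow c)
    split_ifs
    · exact (((Good.coord i).pow 2).sub ((Good.coord j).pow 2)).abs.pow b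
    · exact Good.const 1
  exact this

lemma fabc_nonneg (n b c : ℕ) (x : Fin n → ℝ) : 0 ≤ _root_.fabc n 2 b c x := by
  unfold _root_.fabc
  refine mul_nonneg (Finset.prod_nonneg fun i _ => Finset.prod_nonneg fun j _ => ?_)
    (Finset.prod_nonneg fun i _ => by positivity)
  split_ifs <;> positivity

lemma fabc_perm (n b c : ℕ) (σ : Equiv.Perm (Fin n)) (x : Fin n → ℝ) :
    _root_.fabc n 2 b c (fun i => x (σ i)) = _root_.fabc n 2 b c x := by
  have key : ∀ y : Fin n → ℝ, (∏ i : Fin n, ∏ j : Fin n, if i < j then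
      |y i ^ 2 - y j ^ 2| ^ b else 1) = |(Matrix.vandermonde (fun i => y i ^ 2)).det| ^ b := by
    intro y
    rw [Matrix.det_vandermonde, Finset.abs_prod, ← Finset.prod_pow]
    refine Finset.prod_congr rfl fun i _ => ?_
    rw [Finset.abs_prod, ← Finset.prod_pow, ← Finset.prod_filter]
    refine Finset.prod_congr ?_ fun j _ => by rw [abs_sub_comm]
    ext; simp
  unfold _root_.fabc
  rw [key, key]
  congr 1
  · have : Matrix.vandermonde (fun i => x (σ i) ^ 2) =
        (Matrix.vandermonde (fun i => x i ^ 2)).submatrix σ id := by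
      ext i j; simp [Matrix.vandermonde]
    rw [this, Matrix.det_permute, abs_mul]
    rcases Int.units_eq_one_or (Equiv.Perm.sign σ) with h | h <;> simp [h]
  · exact Equiv.prod_comp σ (fun i => |x i| ^ c)

lemma fabc_cons (m b c : ℕ) (t : ℝ) (y : Fin m → ℝ) :
    _root_.fabc (m+1) 2 b c (Fin.cons t y) =
      (∏ j, |t ^ 2 - y j ^ 2| ^ b) * |t| ^ c * _root_.fabc m 2 b c y := by
  unfold _root_.fabc
  simp only [Fin.prod_univ_succ, Fin.cons_zero, Fin.cons_succ, Fin.succ_lt_succ_iff,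
    Fin.not_lt_zero, if_false, Fin.succ_pos, if_true, one_mul]
  ring

lemma cons_eta {m : ℕ} (x : Fin (m+1) → ℝ) : x = Fin.cons (x 0) (fun i => x i.succ) := by
  ext i; refine Fin.cases ?_ (fun j => ?_) i <;> simp

/-- `fabc` vanishes on the diagonals. -/
lemma fabc_zero (m b c : ℕ) (hb : 1 ≤ b) (x : Fin (m+1) → ℝ) (j : Fin m)
    (h : x 0 ^ 2 - x j.succ ^ 2 = 0) : _root_.fabc (m+1) 2 b c x = 0 := by
  rw [cons_eta x, fabc_cons]
  rw [Finset.prod_eq_zero (Finset.mem_univ j)]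
  · simp
  · simp [h]; omega

lemma Good.fabc_div (m b c : ℕ) (hb : 1 ≤ b) (j : Fin m) :
    Good (fun x : Fin (m+1) → ℝ => _root_.fabc (m+1) 2 b c x / (x 0 ^ 2 - x j.succ ^ 2)) := by
  have hg : Good (fun x : Fin (m+1) → ℝ =>
      (∏ k : Fin m, (1 + |x 0 ^ 2 - x k.succ ^ 2|) ^ b) * |x 0| ^ c *
        ((∏ i : Fin m, ∏ j : Fin m,
        if i < j then |x i.succ ^ 2 - x j.succ ^ 2| ^ b else 1) *
    ∏ i : Fin m, |x i.succ| ^ c)) := by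
    refine Good.mul (Good.mul (Good.prod _ fun k => ?_) ((Good.coord 0).abs.pow c)) ?_
    · exact ((Good.const 1).add (((Good.coord _).pow 2).sub ((Good.coord _).pow 2)).abs).pow b
    refine Good.mul (Good.prod _ fun i => Good.prod _ fun j => ?_)
      (Good.prod _ fun i => (Good.coord _).abs.pow c)
    split_ifs
    · exact (((Good.coord _).pow 2).sub ((Good.coord _).pow 2)).abs.pow b
    · exact Good.const 1
  have hm := (continuous_fabc (m+1) b c).measurable
  refine Good.of_le hg (by fun_prop) fun x => ?_
  conv_lhs => rw [cons_eta x, fabc_cons]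
  simp only [Fin.cons_zero, Fin.cons_succ]
  have h1 : 0 ≤ _root_.fabc m 2 b c (fun i => x i.succ) := fabc_nonneg _ _ _ _
  change _ ≤ _ * _root_.fabc m 2 b c (fun i => x i.succ)
  rw [mul_div_right_comm, abs_mul, abs_of_nonneg h1, mul_div_right_comm, abs_mul,
    abs_of_nonneg (by positivity : (0:ℝ) ≤ |x 0| ^ c)]
  refine mul_le_mul_of_nonneg_right (mul_le_mul_of_nonneg_right ?_ (by positivity)) h1
  rw [← Finset.mul_prod_erase _ _ (Finset.mem_univ j),
    ← Finset.mul_prod_erase _ (fun k => (1 + |x 0 ^ 2 - x k.succ ^ 2|) ^ b) (Finset.mem_univ j),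
    mul_div_right_comm, abs_mul]
  refine mul_le_mul ?_ ?_ (abs_nonneg _) (by positivity)
  · generalize x 0 ^ 2 - x j.succ ^ 2 = s
    rw [abs_div, abs_pow, abs_abs]
    rcases eq_or_ne s 0 with rfl | hs
    · simp
    have hs' := abs_pos.2 hs
    rw [div_le_iff₀ hs']
    obtain ⟨k, rfl⟩ : ∃ k, b = k + 1 := ⟨b - 1, by omega⟩
    rw [pow_succ]
    refine mul_le_mul_of_nonneg_right ?_ hs'.le
    exact (pow_le_pow_left₀ hs'.le (by linarith) k).trans
      (pow_le_pow_right₀ (by linarith) (by omega))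
  · rw [abs_of_nonneg (by positivity)]
    refine Finset.prod_le_prod (fun _ _ => by positivity) fun k _ => ?_
    exact pow_le_pow_left₀ (abs_nonneg _) (by linarith) _

end S15
namespace S15

open Filter Topology

lemma integrable_1d {p : ℝ} (hp : 1 ≤ p) (K : ℕ) :
    Integrable (fun t : ℝ => (1 + |t|) ^ K * Real.exp (-|t| ^ p)) := by
  have h1 : IntegrableOn (fun t : ℝ => (1 + |t|) ^ K * Real.exp (-|t| ^ p)) (Set.Ioi 0) := by
    have e : Set.EqOn (fun t : ℝ => ∑ k ∈ Finset.range (K+1),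
        (K.choose k : ℝ) * (t ^ (k:ℝ) * Real.exp (- t ^ p)))
        (fun t : ℝ => (1 + |t|) ^ K * Real.exp (-|t| ^ p)) (Set.Ioi 0) := by
      intro t ht
      have ht : 0 < t := ht
      simp only [abs_of_pos ht]
      rw [add_comm 1 t, add_pow, Finset.sum_mul]
      refine Finset.sum_congr rfl fun k _ => ?_
      rw [Real.rpow_natCast]; simp; ring
    refine IntegrableOn.congr_fun ?_ e measurableSet_Ioi
    refine integrable_finsetSum _ fun k _ => Integrable.const_mul ?_ _
    exact integrableOn_rpow_mul_exp_neg_rpow (by have := k.cast_nonneg (α := ℝ); linarith) (by linarith)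
  have h2 : IntegrableOn (fun t : ℝ => (1 + |t|) ^ K * Real.exp (-|t| ^ p)) (Set.Iic 0) := by
    rw [← Measure.map_neg_eq_self (volume : Measure ℝ)]
    have me : MeasurableEmbedding fun x : ℝ => -x := (Homeomorph.neg ℝ).measurableEmbedding
    rw [me.integrableOn_map_iff]
    simp only [Function.comp_def, abs_neg, Set.neg_preimage, Set.neg_Iic, neg_zero]
    exact Iff.mpr integrableOn_Ici_iff_integrableOn_Ioi h1
  rw [← integrableOn_univ, ← Set.Iic_union_Ioi (a := (0:ℝ))]
  exact h2.union h1

lemma integrable_good {n : ℕ} {p : ℝ} (hp : 1 ≤ p) {G : (Fin n → ℝ) → ℝ} (hG : Good G) :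
    Integrable (fun x => G x * Real.exp (-∑ i, |x i| ^ p)) := by
  obtain ⟨mG, C, K, hG⟩ := hG
  have h0 : Integrable (fun x : Fin n → ℝ =>
      C * ∏ i, ((1 + |x i|) ^ K * Real.exp (-|x i| ^ p))) :=
    (Integrable.fintype_prod (f := fun _ (t:ℝ) => (1 + |t|) ^ K * Real.exp (-|t| ^ p))
      fun _ => integrable_1d hp K).const_mul C
  refine h0.mono' (by fun_prop) (Eventually.of_forall fun x => ?_)
  rw [Real.norm_eq_abs, abs_mul, abs_of_pos (Real.exp_pos _), Finset.prod_mul_distrib,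
    ← Real.exp_sum, Finset.prod_pow, Finset.sum_neg_distrib, ← mul_assoc]
  exact mul_le_mul_of_nonneg_right (hG x) (Real.exp_pos _).le

lemma Mp_perm {n : ℕ} (b c : ℕ) (p : ℝ) (σ : Equiv.Perm (Fin n)) (G : (Fin n → ℝ) → ℝ) :
    Mp n 2 b c p (fun x => G (fun i => x (σ i))) = Mp n 2 b c p G := by
  unfold Mp
  have h := (volume_measurePreserving_piCongrLeft (fun _ : Fin n => ℝ) σ⁻¹).integral_comp
    (MeasurableEquiv.measurableEmbedding _)
    (fun x => G x * fabc n 2 b c x * Real.exp (-∑ i, |x i| ^ p))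
  rw [← h]
  refine integral_congr_ae (Eventually.of_forall fun x => ?_)
  have e : (MeasurableEquiv.piCongrLeft (fun _ : Fin n => ℝ) σ⁻¹) x = fun i => x (σ i) := by
    ext i
    have := MeasurableEquiv.piCongrLeft_apply_apply (β := fun _ : Fin n => ℝ) σ⁻¹ x (σ i)
    simpa using this
  simp only [e, fabc_perm]
  rw [Equiv.sum_comp σ (fun i => |x i| ^ p)]

/-- Symmetrization of the singular kernel. -/
lemma Mp_symm {m : ℕ} {b c : ℕ} (hb : 1 ≤ b) {p : ℝ} (hp : 1 ≤ p) (j : Fin m)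
    {G : (Fin (m+1) → ℝ) → ℝ} (hG : Good G) :
    2 * Mp (m+1) 2 b c p (fun x => G x / (x 0 ^ 2 - x j.succ ^ 2)) =
      Mp (m+1) 2 b c p (fun x => (G x - G (fun i => x (Equiv.swap 0 j.succ i)))
        / (x 0 ^ 2 - x j.succ ^ 2)) := by
  have h := Mp_perm b c p (Equiv.swap 0 j.succ) (fun x => G x / (x 0 ^ 2 - x j.succ ^ 2))
  have hG' : Good (fun x => G (fun i => x (Equiv.swap 0 j.succ i))) := by
    obtain ⟨mG, C, K, hG⟩ := hG
    refine ⟨mG.comp (by fun_prop), C, K, fun x => (hG _).trans (le_of_eq ?_)⟩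
    congr 2
    exact Equiv.prod_comp (Equiv.swap 0 j.succ) (fun i => 1 + |x i|)
  have i1 := integrable_good hp (hG.mul (Good.fabc_div m b c hb j))
  have i2 := integrable_good hp (hG'.mul (Good.fabc_div m b c hb j))
  rw [two_mul]
  nth_rw 1 [← h]
  unfold Mp
  simp only [Equiv.swap_apply_left, Equiv.swap_apply_right]
  rw [← integral_add]
  · refine integral_congr_ae (Eventually.of_forall fun x => ?_)
    simp only
    rw [← neg_sub (x 0 ^ 2) (x j.succ ^ 2), div_neg]
    ring
  · refine i2.neg.congr (Eventually.of_forall fun x => ?_)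
    simp only [Pi.neg_apply]
    rw [← neg_sub (x 0 ^ 2) (x j.succ ^ 2), div_neg]
    ring
  · refine i1.congr (Eventually.of_forall fun x => ?_)
    simp only
    ring

lemma integral_zero_1d {φ φ' : ℝ → ℝ} {s : Set ℝ} (hs : s.Countable) (hc : Continuous φ)
    (hd : ∀ t, t ∉ s → HasDerivAt φ (φ' t) t) (hi : Integrable φ')
    (h1 : Tendsto φ atTop (𝓝 0)) (h2 : Tendsto φ atBot (𝓝 0)) : ∫ t, φ' t = 0 := by
  have a1 := intervalIntegral_tendsto_integral hi (tendsto_neg_atTop_atBot (G := ℝ)) tendsto_id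
  have a2 : Tendsto (fun R : ℝ => φ R - φ (-R)) atTop (𝓝 (0 - 0)) :=
    h1.sub (h2.comp tendsto_neg_atTop_atBot)
  have e : (fun R : ℝ => ∫ t in (-R)..(id R), φ' t) = fun R : ℝ => φ R - φ (-R) := by
    funext R
    exact integral_eq_of_hasDerivAt_off_countable φ φ' hs hc.continuousOn
      (fun t ht => hd t ht.2) hi.intervalIntegrable
  rw [e] at a1
  have := tendsto_nhds_unique a1 a2
  simpa using this

lemma integral_zero_nd {m : ℕ} {F F' : (Fin (m+1) → ℝ) → ℝ} (hi : Integrable F')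
    (s : (Fin m → ℝ) → Set ℝ) (hs : ∀ y, (s y).Countable)
    (hc : ∀ y, Continuous (fun t : ℝ => F (Fin.cons t y)))
    (hd : ∀ y t, t ∉ s y → HasDerivAt (fun t : ℝ => F (Fin.cons t y)) (F' (Fin.cons t y)) t)
    (h1 : ∀ y, Tendsto (fun t : ℝ => F (Fin.cons t y)) atTop (𝓝 0))
    (h2 : ∀ y, Tendsto (fun t : ℝ => F (Fin.cons t y)) atBot (𝓝 0)) : ∫ x, F' x = 0 := by
  have mp := (volume_preserving_piFinSuccAbove (fun _ : Fin (m+1) => ℝ) 0).symm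
  have e : ∀ z : ℝ × (Fin m → ℝ),
      (MeasurableEquiv.piFinSuccAbove (fun _ : Fin (m+1) => ℝ) 0).symm z = Fin.cons z.1 z.2 := by
    intro z; ext i; simp [MeasurableEquiv.piFinSuccAbove, Fin.insertNthEquiv]
  have i1 : Integrable (fun z : ℝ × (Fin m → ℝ) => F' (Fin.cons z.1 z.2)) := by
    have := mp.integrable_comp_of_integrable hi
    simpa only [Function.comp_def, e] using this
  rw [← mp.integral_comp (MeasurableEquiv.measurableEmbedding _)]
  simp only [e]
  rw [Measure.volume_eq_prod] at i1 ⊢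
  rw [integral_prod_symm _ i1]
  rw [integral_eq_zero_of_ae]
  filter_upwards [i1.prod_left_ae] with y hy
  exact integral_zero_1d (hs y) (hc y) (hd y) hy (h1 y) (h2 y)

end S15
namespace S15

open Filter Topology

/-- Logarithmic derivative. -/
def LD (f : ℝ → ℝ) (l t : ℝ) : Prop := HasDerivAt f (l * f t) t

lemma LD.mul {f g : ℝ → ℝ} {l k t : ℝ} (hf : LD f l t) (hg : LD g k t) :
    LD (fun s => f s * g s) (l + k) t := by
  unfold LD at *
  refine (HasDerivAt.fun_mul hf hg).congr_deriv ?_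
  ring

lemma LD.const (a t : ℝ) : LD (fun _ => a) 0 t := by
  unfold LD; simpa using hasDerivAt_const t a

lemma LD.prod {ι : Type*} (s : Finset ι) {f : ι → ℝ → ℝ} {l : ι → ℝ} {t : ℝ}
    (h : ∀ i, LD (f i) (l i) t) : LD (fun u => ∏ i ∈ s, f i u) (∑ i ∈ s, l i) t := by
  classical
  induction s using Finset.induction_on with
  | empty => simpa using LD.const 1 t
  | insert a s ha ih => simpa [Finset.prod_insert ha, Finset.sum_insert ha] using (h a).mul ih

lemma LD.id {t : ℝ} (ht : t ≠ 0) : LD (fun s => s) (1 / t) t := by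
  unfold LD; simpa [ht] using hasDerivAt_id' t

lemma LD.rpow {t : ℝ} (ht : t ≠ 0) (r : ℝ) : LD (fun s => |s| ^ r) (r / t) t := by
  unfold LD
  have h := (hasDerivAt_abs ht).rpow_const (p := r) (Or.inl (abs_ne_zero.2 ht))
  convert h using 1
  rw [Real.rpow_sub_one (abs_ne_zero.2 ht)]
  rcases lt_or_gt_of_ne ht with h | h
  · simp [h, abs_of_neg h]; field_simp
  · simp [h, abs_of_pos h]; field_simp

lemma LD.expn {t : ℝ} (ht : t ≠ 0) (p : ℝ) :
    LD (fun s => Real.exp (-|s| ^ p)) (-(p * |t| ^ p / t)) t := by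
  have h := LD.rpow ht p
  unfold LD at *
  convert h.fun_neg.exp using 1
  ring

lemma LD.absdiff {t y : ℝ} (h : t ^ 2 - y ^ 2 ≠ 0) (b : ℕ) (hb : 1 ≤ b) :
    LD (fun s => |s ^ 2 - y ^ 2| ^ b) (b * (2 * t / (t ^ 2 - y ^ 2))) t := by
  unfold LD
  have h1 : HasDerivAt (fun s : ℝ => s ^ 2 - y ^ 2) (2 * t) t := by
    simpa using (hasDerivAt_pow 2 t).sub_const (y ^ 2)
  have h2 := (HasDerivAt.comp t (hasDerivAt_abs h) h1).fun_pow b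
  refine h2.congr_deriv ?_
  obtain ⟨k, rfl⟩ : ∃ k, b = k + 1 := ⟨b - 1, by omega⟩
  simp only [Function.comp, Nat.add_sub_cancel]
  clear h2 h1
  generalize t ^ 2 - y ^ 2 = d at h ⊢
  rw [pow_succ]
  rcases lt_or_gt_of_ne h with h | h
  · rw [abs_of_neg h, sign_neg h]
    have := h.ne
    field_simp
    simp
  · rw [abs_of_pos h, sign_pos h]
    have := h.ne'
    field_simp
    simp

lemma tendsto_aux {p : ℝ} (hp : 1 ≤ p) (K : ℕ) :
    Tendsto (fun t : ℝ => (1 + |t|) ^ K * Real.exp (-|t| ^ p)) atTop (𝓝 0) := by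
  have h := ((Real.tendsto_pow_mul_exp_neg_atTop_nhds_zero K).comp
    (tendsto_atTop_add_const_left atTop (1:ℝ) tendsto_id)).const_mul (Real.exp 1)
  rw [mul_zero] at h
  refine squeeze_zero' (Eventually.of_forall fun t => by positivity) ?_ h
  filter_upwards [eventually_ge_atTop 1] with t ht
  simp only [Function.comp, id]
  rw [abs_of_nonneg (by linarith), mul_left_comm, ← Real.exp_add]
  refine mul_le_mul_of_nonneg_left (Real.exp_le_exp.2 ?_) (by positivity)
  have := Real.self_le_rpow_of_one_le ht hp
  linarith

lemma tendsto_aux' {p : ℝ} (hp : 1 ≤ p) (K : ℕ) :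
    Tendsto (fun t : ℝ => (1 + |t|) ^ K * Real.exp (-|t| ^ p)) atBot (𝓝 0) := by
  simpa [Function.comp_def] using (tendsto_aux hp K).comp tendsto_neg_atBot_atTop

lemma bound_cons {m : ℕ} {p : ℝ} {G : (Fin (m+1) → ℝ) → ℝ} (hG : Good G) (y : Fin m → ℝ) :
    ∃ (D : ℝ) (K : ℕ), ∀ t : ℝ, ‖G (Fin.cons t y) *
      Real.exp (-∑ i, |(Fin.cons t y : Fin (m+1) → ℝ) i| ^ p)‖ ≤
        D * ((1 + |t|) ^ K * Real.exp (-|t| ^ p)) := by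
  obtain ⟨mG, C, K, hG⟩ := hG
  refine ⟨C * Pw y ^ K * Real.exp (-∑ i, |y i| ^ p), K, fun t => ?_⟩
  rw [Real.norm_eq_abs, abs_mul, abs_of_pos (Real.exp_pos _)]
  have h1 := hG (Fin.cons t y)
  have h2 : Pw (Fin.cons t y : Fin (m+1) → ℝ) = (1 + |t|) * Pw y := by
    unfold Pw; simp [Fin.prod_univ_succ]
  rw [h2, mul_pow] at h1
  rw [Fin.sum_univ_succ]
  simp only [Fin.cons_zero, Fin.cons_succ, neg_add, Real.exp_add]
  refine (mul_le_mul_of_nonneg_right h1 (by positivity)).trans (le_of_eq ?_)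
  ring

lemma ibp {m b c : ℕ} (hb : 1 ≤ b) {p r : ℝ} (hp : 1 ≤ p) (hr : 0 ≤ r)
    {h : (Fin m → ℝ) → ℝ} (hh : Good (fun x : Fin (m+1) → ℝ => h (fun i => x i.succ))) :
    (r + 1 + c) * Mp (m+1) 2 b c p (fun x => |x 0| ^ r * h (fun i => x i.succ))
      + b * ∑ k : Fin m, Mp (m+1) 2 b c p (fun x =>
        (2 * x 0 ^ 2 * |x 0| ^ r * h (fun i => x i.succ)) / (x 0 ^ 2 - x k.succ ^ 2))
      = p * Mp (m+1) 2 b c p (fun x => |x 0| ^ (r + p) * h (fun i => x i.succ)) := by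
  have g1 : Good (fun x : Fin (m+1) → ℝ => (|x 0| ^ r * h (fun i => x i.succ))
      * fabc (m+1) 2 b c x) := ((Good.rpow 0 hr).mul hh).mul (Good.fabc _ b c)
  have g2 : Good (fun x : Fin (m+1) → ℝ => (|x 0| ^ (r+p) * h (fun i => x i.succ))
      * fabc (m+1) 2 b c x) := ((Good.rpow 0 (by linarith)).mul hh).mul (Good.fabc _ b c)
  have g3 : ∀ k : Fin m, Good (fun x : Fin (m+1) → ℝ =>
      ((2 * x 0 ^ 2 * |x 0| ^ r * h (fun i => x i.succ)) / (x 0 ^ 2 - x k.succ ^ 2))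
      * fabc (m+1) 2 b c x) := fun k => by
    have := ((((Good.const 2).mul ((Good.coord (0 : Fin (m+1))).pow 2)).mul
      (Good.rpow 0 hr)).mul hh).mul (Good.fabc_div m b c hb k)
    convert this using 2
    ring
  have g4 : Good (fun x : Fin (m+1) → ℝ => x 0 * (|x 0| ^ r * h (fun i => x i.succ))
      * fabc (m+1) 2 b c x) := ((Good.coord 0).mul ((Good.rpow 0 hr).mul hh)).mul (Good.fabc _ b c)
  have i1 := integrable_good hp g1
  have i2 := integrable_good hp g2
  have i3 := fun k => integrable_good hp (g3 k)
  have i4 := ((i1.const_mul (r+1+c)).add ((integrable_finsetSum Finset.univ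
    fun k _ => i3 k).const_mul (b:ℝ))).sub (i2.const_mul p)
  have key := integral_zero_nd
    (F := fun x => x 0 * (|x 0| ^ r * h (fun i => x i.succ))
      * fabc (m+1) 2 b c x * Real.exp (-∑ i, |x i| ^ p)) i4
    (fun y => {0} ∪ ⋃ k, {t | t ^ 2 - y k ^ 2 = 0}) ?_ ?_ ?_ ?_ ?_
  · simp only [Pi.sub_apply, Pi.add_apply] at key
    rw [integral_sub (by exact (i1.const_mul (r+1+c)).add ((integrable_finsetSum Finset.univ
      fun k _ => i3 k).const_mul (b:ℝ))) (i2.const_mul p),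
      integral_add (i1.const_mul (r+1+c)) ((integrable_finsetSum Finset.univ
      fun k _ => i3 k).const_mul (b:ℝ)), integral_const_mul, integral_const_mul,
      integral_const_mul, integral_finsetSum _ (fun k _ => i3 k)] at key
    unfold Mp
    linarith
  · intro y
    refine (Set.countable_singleton _).union (Set.countable_iUnion fun k => ?_)
    refine Set.Countable.mono (s₂ := {y k, -y k}) ?_ (Set.to_countable _)
    intro t ht
    have : t ^ 2 = y k ^ 2 := by simpa [sub_eq_zero] using ht
    simpa using sq_eq_sq_iff_eq_or_eq_neg.1 this
  · intro y
    have hf := (continuous_fabc (m+1) b c)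
    have hcons : Continuous (fun t : ℝ => (Fin.cons t y : Fin (m+1) → ℝ)) := by
      refine continuous_pi fun i => ?_
      refine Fin.cases ?_ (fun j => ?_) i
      · simpa using continuous_id'
      · simpa using continuous_const
    simp only [Fin.cons_zero, Fin.cons_succ, Fin.sum_univ_succ]
    have h1 : Continuous (fun t : ℝ => |t| ^ r) :=
      continuous_abs.rpow_const fun _ => Or.inr hr
    have h2 : Continuous (fun t : ℝ => |t| ^ p) :=
      continuous_abs.rpow_const fun _ => Or.inr (by linarith)
    have h3 := hf.comp hcons
    simp only [Function.comp_def] at h3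
    fun_prop
  · intro y t ht
    simp only [Set.mem_union, Set.mem_singleton_iff, Set.mem_iUnion, Set.mem_ofPred_eq,
      not_or, not_exists] at ht
    obtain ⟨ht, hk⟩ := ht
    have := ((((LD.id ht).mul (LD.rpow ht r)).mul ((LD.prod Finset.univ fun k =>
      LD.absdiff (hk k) b hb).mul (LD.rpow ht c))).mul (LD.expn ht p)).mul
      (LD.const (h y * fabc m 2 b c y * Real.exp (-∑ i, |y i| ^ p)) t)
    unfold LD at this
    simp only [Pi.sub_apply, Pi.add_apply]
    simp only [Fin.cons_zero, Fin.cons_succ, Fin.sum_univ_succ, fabc_cons, neg_add, Real.exp_add]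
    convert this using 1
    · funext s
      rw [Real.rpow_natCast]
      ring
    · simp only
      rw [Real.rpow_natCast, Real.rpow_add (abs_pos.2 ht), ← Finset.mul_sum]
      have e : ∀ x, 2 * t ^ 2 * |t| ^ r * h y / (t ^ 2 - y x ^ 2) *
          ((∏ j, |t ^ 2 - y j ^ 2| ^ b) * |t| ^ c * fabc m 2 b c y) *
          (rexp (-|t| ^ p) * rexp (-∑ i, |y i| ^ p)) = (2 * t / (t ^ 2 - y x ^ 2)) *
          (t * |t| ^ r * h y * ((∏ j, |t ^ 2 - y j ^ 2| ^ b) * |t| ^ c * fabc m 2 b c y) *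
          (rexp (-|t| ^ p) * rexp (-∑ i, |y i| ^ p))) := by intro x; ring
      simp only [e]
      rw [← Finset.sum_mul]
      field_simp
      ring
  · intro y
    obtain ⟨D, K, hD⟩ := bound_cons (p := p) g4 y
    have := (tendsto_aux hp K).const_mul D
    rw [mul_zero] at this
    exact squeeze_zero_norm hD this
  · intro y
    obtain ⟨D, K, hD⟩ := bound_cons (p := p) g4 y
    have := (tendsto_aux' hp K).const_mul D
    rw [mul_zero] at this
    exact squeeze_zero_norm hD this

end S15
namespace S15

open Filter Topology

lemma Mp_int {n b c : ℕ} {p : ℝ} (hp : 1 ≤ p) {G : (Fin n → ℝ) → ℝ} (hG : Good G) :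
    Integrable (fun x => G x * fabc n 2 b c x * Real.exp (-∑ i, |x i| ^ p)) :=
  integrable_good hp (hG.mul (Good.fabc n b c))

lemma Mp_add {n b c : ℕ} {p : ℝ} (hp : 1 ≤ p) {F G : (Fin n → ℝ) → ℝ} (hF : Good F)
    (hG : Good G) : Mp n 2 b c p (fun x => F x + G x) = Mp n 2 b c p F + Mp n 2 b c p G := by
  unfold Mp
  rw [← integral_add (Mp_int hp hF) (Mp_int hp hG)]
  congr 1; funext x; ring

lemma Mp_cmul {n b c : ℕ} {p : ℝ} (a : ℝ) (F : (Fin n → ℝ) → ℝ) :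
    Mp n 2 b c p (fun x => a * F x) = a * Mp n 2 b c p F := by
  unfold Mp
  rw [← integral_const_mul]
  congr 1; funext x; ring

lemma Mp_mono {n b c : ℕ} {p : ℝ} (hp : 1 ≤ p) {F G : (Fin n → ℝ) → ℝ} (hF : Good F)
    (hG : Good G) (h : ∀ x, F x ≤ G x) : Mp n 2 b c p F ≤ Mp n 2 b c p G := by
  unfold Mp
  refine integral_mono (Mp_int hp hF) (Mp_int hp hG) fun x => ?_
  exact mul_le_mul_of_nonneg_right (mul_le_mul_of_nonneg_right (h x) (fabc_nonneg _ _ _ _))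
    (Real.exp_pos _).le

lemma Mp_nonneg {n b c : ℕ} {p : ℝ} {G : (Fin n → ℝ) → ℝ} (h : ∀ x, 0 ≤ G x) :
    0 ≤ Mp n 2 b c p G :=
  integral_nonneg fun x => mul_nonneg (mul_nonneg (h x) (fabc_nonneg _ _ _ _)) (Real.exp_pos _).le

lemma Mp_div_congr {m b c : ℕ} (hb : 1 ≤ b) {p : ℝ} (k : Fin m)
    {G H : (Fin (m+1) → ℝ) → ℝ}
    (h : ∀ x, x 0 ^ 2 - x k.succ ^ 2 ≠ 0 → G x / (x 0 ^ 2 - x k.succ ^ 2) = H x) :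
    Mp (m+1) 2 b c p (fun x => G x / (x 0 ^ 2 - x k.succ ^ 2)) = Mp (m+1) 2 b c p H := by
  unfold Mp
  congr 1; funext x
  by_cases hx : x 0 ^ 2 - x k.succ ^ 2 = 0
  · rw [fabc_zero m b c hb x k hx]; simp
  · simp only [h x hx]

lemma Mp_div_le {m b c : ℕ} (hb : 1 ≤ b) {p : ℝ} (hp : 1 ≤ p) (k : Fin m)
    {G H : (Fin (m+1) → ℝ) → ℝ} (hG : Good G) (hH : Good H)
    (h : ∀ x, x 0 ^ 2 - x k.succ ^ 2 ≠ 0 → G x / (x 0 ^ 2 - x k.succ ^ 2) ≤ H x) :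
    Mp (m+1) 2 b c p (fun x => G x / (x 0 ^ 2 - x k.succ ^ 2)) ≤ Mp (m+1) 2 b c p H := by
  unfold Mp
  refine integral_mono ?_ (Mp_int hp hH) fun x => ?_
  · have := integrable_good hp (hG.mul (Good.fabc_div m b c hb k))
    refine this.congr (Eventually.of_forall fun x => ?_)
    simp only
    ring
  · simp only
    by_cases hx : x 0 ^ 2 - x k.succ ^ 2 = 0
    · rw [fabc_zero m b c hb x k hx]; simp
    · exact mul_le_mul_of_nonneg_right (mul_le_mul_of_nonneg_right (h x hx)
        (fabc_nonneg _ _ _ _)) (Real.exp_pos _).le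

lemma slope_aux {e s t : ℝ} (he : 1 ≤ e) (hs : 0 < s) (ht : 0 ≤ t) :
    s ^ e - t ^ e ≤ e * s ^ (e - 1) * (s - t) := by
  have h := one_add_mul_self_le_rpow_one_add (s := t / s - 1)
    (by have := div_nonneg ht hs.le; linarith) he
  rw [add_sub_cancel, Real.div_rpow ht hs.le, le_div_iff₀ (Real.rpow_pos_of_pos hs _)] at h
  rw [Real.rpow_sub_one hs.ne']
  have : e * (s ^ e / s) * (s - t) = s ^ e - (1 + e * (t / s - 1)) * s ^ e := by
    field_simp; ring
  linarith

lemma slope_le {e s t : ℝ} (he : 1 ≤ e) (hs : 0 ≤ s) (ht : 0 ≤ t) (h : s - t ≠ 0) :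
    (s ^ e - t ^ e) / (s - t) ≤ e * (s ^ (e - 1) + t ^ (e - 1)) := by
  have h1 := Real.rpow_nonneg hs (e - 1)
  have h2 := Real.rpow_nonneg ht (e - 1)
  rcases lt_or_gt_of_ne h with h | h
  · have := slope_aux he (by linarith : 0 < t) hs
    rw [div_le_iff_of_neg h]
    nlinarith [mul_nonneg (mul_nonneg (by linarith : 0 ≤ e) h1) (by linarith : 0 ≤ t - s)]
  · have := slope_aux he (by linarith : 0 < s) ht
    rw [div_le_iff₀ h]
    nlinarith [mul_nonneg (mul_nonneg (by linarith : 0 ≤ e) h2) (by linarith : 0 ≤ s - t)]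

lemma sq_rpow (a p : ℝ) : (a ^ 2) ^ (p / 2) = |a| ^ p := by
  rw [← sq_abs, ← Real.rpow_natCast, ← Real.rpow_mul (abs_nonneg _)]
  congr 1; push_cast; ring

lemma mul_rpow_pred {s e : ℝ} (hs : 0 ≤ s) (he : 1 ≤ e) : s * s ^ (e - 1) = s ^ e := by
  rcases hs.eq_or_lt with rfl | h
  · rw [zero_mul, Real.zero_rpow (by linarith)]
  · rw [Real.rpow_sub_one h.ne']; field_simp

lemma slope1 {p a d : ℝ} (hp : 2 ≤ p) (h : a ^ 2 - d ^ 2 ≠ 0) :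
    (a ^ 2 * |a| ^ p - d ^ 2 * |d| ^ p) / (a ^ 2 - d ^ 2) ≤ (p / 2 + 1) * (|a| ^ p + |d| ^ p) := by
  have := slope_le (e := p / 2 + 1) (by linarith) (sq_nonneg a) (sq_nonneg d) h
  rw [← mul_rpow_pred (sq_nonneg a) (by linarith), ← mul_rpow_pred (sq_nonneg d) (by linarith),
    add_sub_cancel_right, sq_rpow, sq_rpow] at this
  exact this

lemma slope2 {p a d : ℝ} (hp : 2 ≤ p) (h : a ^ 2 - d ^ 2 ≠ 0) :
    a ^ 2 * d ^ 2 * (|a| ^ p - |d| ^ p) / (a ^ 2 - d ^ 2) ≤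
      (p / 2) * (|a| ^ p * d ^ 2 + |d| ^ p * a ^ 2) := by
  have := slope_le (e := p / 2) (by linarith) (sq_nonneg a) (sq_nonneg d) h
  have h2 := mul_le_mul_of_nonneg_left this (by positivity : 0 ≤ a ^ 2 * d ^ 2)
  have e1 := mul_rpow_pred (sq_nonneg a) (by linarith : 1 ≤ p / 2)
  have e2 := mul_rpow_pred (sq_nonneg d) (by linarith : 1 ≤ p / 2)
  rw [sq_rpow] at e1 e2 h2
  rw [sq_rpow] at h2
  rw [mul_div_assoc]
  refine h2.trans (le_of_eq ?_)
  rw [← e1, ← e2]; ring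

section ids
variable {m b c : ℕ} {p : ℝ}

lemma M_coord (k : Fin (m+2)) :
    Mp (m+2) 2 b c p (fun x => x k ^ 2) = Mp (m+2) 2 b c p (fun x => x 0 ^ 2) := by
  have := Mp_perm b c p (Equiv.swap 0 k) (fun x => x 0 ^ 2)
  simpa using this

lemma swap_one (j : Fin m) : (Equiv.swap (0 : Fin (m+2)) j.succ.succ) 1 = 1 := by
  apply Equiv.swap_apply_of_ne_of_ne
  · simp
  · intro h
    have := congrArg Fin.val h
    simp at this

lemma M_prod (j : Fin m) (φ : ℝ → ℝ) :
    Mp (m+2) 2 b c p (fun x => φ (x j.succ.succ) * x 1 ^ 2) =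
      Mp (m+2) 2 b c p (fun x => φ (x 0) * x 1 ^ 2) := by
  have := Mp_perm b c p (Equiv.swap 0 j.succ.succ) (fun x => φ (x 0) * x 1 ^ 2)
  simpa [swap_one] using this

lemma M_prod01 (φ : ℝ → ℝ) :
    Mp (m+2) 2 b c p (fun x => φ (x 1) * x 0 ^ 2) =
      Mp (m+2) 2 b c p (fun x => φ (x 0) * x 1 ^ 2) := by
  have := Mp_perm b c p (Equiv.swap (0 : Fin (m+2)) 1) (fun x => φ (x 0) * x 1 ^ 2)
  simpa using this

lemma I1 (hb : 1 ≤ b) (hp : 1 ≤ p) :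
    (1 + c + b * (m+1)) * Mp (m+2) 2 b c p (fun _ => 1) =
      p * Mp (m+2) 2 b c p (fun x => |x 0| ^ p) := by
  have h := ibp (m := m+1) (c := c) hb hp le_rfl (h := fun _ => 1) (Good.const 1)
  have hk : ∀ k : Fin (m+1), Mp (m+2) 2 b c p (fun x =>
        (2 * x 0 ^ 2 * |x 0| ^ (0:ℝ) * 1) / (x 0 ^ 2 - x k.succ ^ 2)) =
        Mp (m+2) 2 b c p (fun _ => 1) := by
    intro k
    have h1 := Mp_symm (c := c) hb hp k (((((Good.const 2).mul ((Good.coord (0 : Fin (m+2))).pow 2)).mul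
      (Good.rpow 0 le_rfl)).mul (Good.const 1)))
    have h2 : Mp (m+2) 2 b c p _ = Mp (m+2) 2 b c p (fun _ => 2 * 1) :=
      h1.symm.trans (h1.trans (Mp_div_congr hb k ?_))
    · rw [Mp_cmul] at h2
      linarith
    · intro x hx
      simp
      field_simp
  simp only [hk] at h
  simp at h
  linarith

lemma I2 (hb : 1 ≤ b) (hp : 1 ≤ p) :
    (3 + c + 2 * b * (m+1)) * Mp (m+2) 2 b c p (fun x => x 0 ^ 2) =
      p * Mp (m+2) 2 b c p (fun x => |x 0| ^ (2 + p)) := by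
  have h := ibp (m := m+1) (c := c) (r := 2) hb hp (by norm_num) (h := fun _ => 1) (Good.const 1)
  have hk : ∀ k : Fin (m+1), Mp (m+2) 2 b c p (fun x =>
        (2 * x 0 ^ 2 * |x 0| ^ (2:ℝ) * 1) / (x 0 ^ 2 - x k.succ ^ 2)) =
        2 * Mp (m+2) 2 b c p (fun x => x 0 ^ 2) := by
    intro k
    have h1 := Mp_symm (c := c) hb hp k (((((Good.const 2).mul ((Good.coord (0 : Fin (m+2))).pow 2)).mul
      (Good.rpow 0 (by norm_num : (0:ℝ) ≤ 2))).mul (Good.const 1)))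
    have h2 : Mp (m+2) 2 b c p _ = Mp (m+2) 2 b c p (fun x => 2 * (x 0 ^ 2 + x k.succ ^ 2)) :=
      h1.symm.trans (h1.trans (Mp_div_congr hb k ?_))
    · rw [Mp_cmul, Mp_add hp ((Good.coord _).pow 2) ((Good.coord _).pow 2), M_coord k.succ] at h2
      linarith
    · intro x hx
      simp
      field_simp
      ring
  simp only [hk] at h
  simp at h
  linarith

lemma I3 (hb : 1 ≤ b) (hp : 1 ≤ p) :
    (1 + c + b * m) * Mp (m+2) 2 b c p (fun x => x 0 ^ 2) =
      p * Mp (m+2) 2 b c p (fun x => |x 0| ^ p * x 1 ^ 2) := by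
  have h := ibp (m := m+1) (c := c) hb hp le_rfl (h := fun y => y 0 ^ 2) ((Good.coord _).pow 2)
  have hG := (((((Good.const 2).mul ((Good.coord (0 : Fin (m+2))).pow 2)).mul
      (Good.rpow 0 (le_refl (0:ℝ)))).mul ((Good.coord 1).pow 2)))
  have hk0 : Mp (m+2) 2 b c p (fun x =>
        (2 * x 0 ^ 2 * |x 0| ^ (0:ℝ) * x 1 ^ 2) / (x 0 ^ 2 - x (Fin.succ 0) ^ 2)) = 0 := by
    have h1 := Mp_symm (c := c) hb hp 0 hG
    have h2 : Mp (m+2) 2 b c p _ = Mp (m+2) 2 b c p (fun x => 0 * 1) :=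
      h1.symm.trans (h1.trans (Mp_div_congr hb 0 ?_))
    · rw [Mp_cmul] at h2
      linarith
    · intro x hx
      simp
      left; ring
  have hk : ∀ k : Fin m, Mp (m+2) 2 b c p (fun x =>
        (2 * x 0 ^ 2 * |x 0| ^ (0:ℝ) * x 1 ^ 2) / (x 0 ^ 2 - x k.succ.succ ^ 2)) =
        Mp (m+2) 2 b c p (fun x => x 0 ^ 2) := by
    intro k
    have h1 := Mp_symm (c := c) hb hp k.succ hG
    have h2 : Mp (m+2) 2 b c p _ = Mp (m+2) 2 b c p (fun x => 2 * (x 1 ^ 2)) :=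
      h1.symm.trans (h1.trans (Mp_div_congr hb k.succ ?_))
    · rw [Mp_cmul, M_coord 1] at h2
      linarith
    · intro x hx
      simp [swap_one]
      field_simp
  rw [Fin.sum_univ_succ] at h
  simp only [Fin.succ_zero_eq_one] at hk0
  simp only [Fin.succ_zero_eq_one, hk, hk0] at h
  simp [M_coord 1] at h
  linarith

lemma I4 (hb : 1 ≤ b) (hp : 1 ≤ p) :
    (3 + c + b + 2 * b * m) * Mp (m+2) 2 b c p (fun x => x 0 ^ 2 * x 1 ^ 2) =
      p * Mp (m+2) 2 b c p (fun x => |x 0| ^ (2 + p) * x 1 ^ 2) := by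
  have h := ibp (m := m+1) (c := c) (r := 2) hb hp (by norm_num)
    (h := fun y => y 0 ^ 2) ((Good.coord _).pow 2)
  have hG := (((((Good.const 2).mul ((Good.coord (0 : Fin (m+2))).pow 2)).mul
      (Good.rpow 0 (by norm_num : (0:ℝ) ≤ 2))).mul ((Good.coord 1).pow 2)))
  have hk0 : Mp (m+2) 2 b c p (fun x =>
        (2 * x 0 ^ 2 * |x 0| ^ (2:ℝ) * x 1 ^ 2) / (x 0 ^ 2 - x (Fin.succ 0) ^ 2)) =
        Mp (m+2) 2 b c p (fun x => x 0 ^ 2 * x 1 ^ 2) := by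
    have h1 := Mp_symm (c := c) hb hp 0 hG
    have h2 : Mp (m+2) 2 b c p _ = Mp (m+2) 2 b c p (fun x => 2 * (x 0 ^ 2 * x 1 ^ 2)) :=
      h1.symm.trans (h1.trans (Mp_div_congr hb 0 ?_))
    · rw [Mp_cmul] at h2
      linarith
    · intro x hx
      simp at hx ⊢
      field_simp
  have hk : ∀ k : Fin m, Mp (m+2) 2 b c p (fun x =>
        (2 * x 0 ^ 2 * |x 0| ^ (2:ℝ) * x 1 ^ 2) / (x 0 ^ 2 - x k.succ.succ ^ 2)) =
        2 * Mp (m+2) 2 b c p (fun x => x 0 ^ 2 * x 1 ^ 2) := by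
    intro k
    have h1 := Mp_symm (c := c) hb hp k.succ hG
    have h2 : Mp (m+2) 2 b c p _ = Mp (m+2) 2 b c p (fun x =>
        2 * (x 0 ^ 2 * x 1 ^ 2 + x k.succ.succ ^ 2 * x 1 ^ 2)) :=
      h1.symm.trans (h1.trans (Mp_div_congr hb k.succ ?_))
    · rw [Mp_cmul, Mp_add hp (((Good.coord _).pow 2).mul ((Good.coord _).pow 2))
        (((Good.coord _).pow 2).mul ((Good.coord _).pow 2)), M_prod k (fun t => t ^ 2)] at h2
      linarith
    · intro x hx
      simp [swap_one]
      field_simp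
      ring
  rw [Fin.sum_univ_succ] at h
  simp only [Fin.succ_zero_eq_one] at hk0
  simp only [Fin.succ_zero_eq_one, hk, hk0] at h
  simp at h
  linarith

lemma I5 (hb : 1 ≤ b) (hp : 2 ≤ p) :
    p * Mp (m+2) 2 b c p (fun x => |x 0| ^ (p + p) * x 1 ^ 2) ≤
    (p + 1 + c + b * (p + m * (p + 2))) * Mp (m+2) 2 b c p (fun x => |x 0| ^ p * x 1 ^ 2) := by
  have hp1 : 1 ≤ p := by linarith
  have h := ibp (m := m+1) (c := c) (r := p) hb hp1 (by linarith)
    (h := fun y => y 0 ^ 2) ((Good.coord _).pow 2)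
  have hu : ∀ i : Fin (m+2), Good (fun x : Fin (m+2) → ℝ => |x i| ^ p) :=
    fun i => Good.rpow i (by linarith)
  have hG := (((((Good.const 2).mul ((Good.coord (0 : Fin (m+2))).pow 2)).mul
      (hu 0)).mul ((Good.coord 1).pow 2)))
  have hk0 : Mp (m+2) 2 b c p (fun x =>
        (2 * x 0 ^ 2 * |x 0| ^ p * x 1 ^ 2) / (x 0 ^ 2 - x (Fin.succ 0) ^ 2)) ≤
        p * Mp (m+2) 2 b c p (fun x => |x 0| ^ p * x 1 ^ 2) := by
    have h1 := Mp_symm (c := c) hb hp1 0 hG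
    have h2 : Mp (m+2) 2 b c p _ ≤ Mp (m+2) 2 b c p (fun x =>
        p * (|x 0| ^ p * x 1 ^ 2 + |x 1| ^ p * x 0 ^ 2)) :=
      h1.symm.trans_le (h1.trans_le (Mp_div_le hb hp1 0 ?_ ?_ ?_))
    · rw [Mp_cmul, Mp_add hp1 ((hu 0).mul ((Good.coord _).pow 2))
        ((hu 1).mul ((Good.coord _).pow 2)), M_prod01 (fun t => |t| ^ p)] at h2
      linarith
    · simp only [Equiv.swap_apply_left]
      exact hG.sub ((((Good.const 2).mul ((Good.coord _).pow 2)).mul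
        (hu _)).mul ((Good.coord _).pow 2))
    · exact (Good.const p).mul (((hu 0).mul ((Good.coord _).pow 2)).add
        ((hu 1).mul ((Good.coord _).pow 2)))
    · intro x hx
      simp at hx ⊢
      have := slope2 hp hx
      refine le_of_eq_of_le ?_ ((mul_le_mul_of_nonneg_left this zero_le_two).trans (le_of_eq ?_))
      · ring
      · ring
  have hk : ∀ k : Fin m, Mp (m+2) 2 b c p (fun x =>
        (2 * x 0 ^ 2 * |x 0| ^ p * x 1 ^ 2) / (x 0 ^ 2 - x k.succ.succ ^ 2)) ≤
        (p + 2) * Mp (m+2) 2 b c p (fun x => |x 0| ^ p * x 1 ^ 2) := by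
    intro k
    have h1 := Mp_symm (c := c) hb hp1 k.succ hG
    have h2 : Mp (m+2) 2 b c p _ ≤ Mp (m+2) 2 b c p (fun x =>
        (p + 2) * (|x 0| ^ p * x 1 ^ 2 + |x k.succ.succ| ^ p * x 1 ^ 2)) :=
      h1.symm.trans_le (h1.trans_le (Mp_div_le hb hp1 k.succ ?_ ?_ ?_))
    · rw [Mp_cmul, Mp_add hp1 ((hu _).mul ((Good.coord _).pow 2))
        ((hu _).mul ((Good.coord _).pow 2)), M_prod k (fun t => |t| ^ p)] at h2
      linarith
    · simp only [Equiv.swap_apply_left]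
      exact hG.sub ((((Good.const 2).mul ((Good.coord _).pow 2)).mul
        (hu _)).mul ((Good.coord _).pow 2))
    · exact (Good.const _).mul (((hu 0).mul ((Good.coord _).pow 2)).add
        ((hu _).mul ((Good.coord _).pow 2)))
    · intro x hx
      simp [swap_one] at hx ⊢
      have := slope1 hp hx
      refine le_of_eq_of_le ?_ ((mul_le_mul_of_nonneg_left this
        (by positivity : 0 ≤ 2 * x 1 ^ 2)).trans (le_of_eq ?_))
      · ring
      · ring
  rw [Fin.sum_univ_succ] at h
  have hs := Finset.sum_le_sum (s := Finset.univ) fun k (_ : k ∈ Finset.univ) => hk k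
  simp only [Fin.succ_zero_eq_one] at hk0
  simp only [Fin.succ_zero_eq_one] at h
  rw [← h]
  simp at hs
  have hb0 : (0:ℝ) ≤ b := b.cast_nonneg
  have := mul_le_mul_of_nonneg_left (add_le_add hk0 hs) hb0
  linarith

end ids

end S15
namespace S15

open Filter Topology

section
variable {m b c : ℕ} {p : ℝ}

lemma J1 (hb : 1 ≤ b) (hp : 2 ≤ p) :
    (1 + c + b * (m+1)) * (((1 + c + b * (m+1)) / p) ^ (2 / p)) * Mp (m+2) 2 b c p (fun _ => 1) ≤
      p * Mp (m+2) 2 b c p (fun x => |x 0| ^ (2 + p)) := by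
  have hp1 : 1 ≤ p := by linarith
  have hp0 : 0 < p := by linarith
  have h1 := I1 (m := m) (c := c) hb hp1
  have hA : (0:ℝ) < 1 + c + b * (m+1) := by positivity
  set A : ℝ := 1 + c + b * (m+1) with hAd
  set κ := A / p with hκ
  have hκ0 : 0 < κ := div_pos hA hp0
  have hθ : 0 ≤ 2 / p := by positivity
  have pt : ∀ x : Fin (m+2) → ℝ, (κ ^ (1 + 2/p) * (-(2/p))) * 1 +
      (κ ^ (1 + 2/p) * ((1 + 2/p) / κ)) * |x 0| ^ p ≤ |x 0| ^ (2 + p) := by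
    intro x
    have hv : 0 ≤ |x 0| ^ p := Real.rpow_nonneg (abs_nonneg _) _
    have h := one_add_mul_self_le_rpow_one_add (s := |x 0| ^ p / κ - 1) (p := 1 + 2/p)
      (by have := div_nonneg hv hκ0.le; linarith) (by linarith)
    rw [add_sub_cancel, Real.div_rpow hv hκ0.le, le_div_iff₀ (Real.rpow_pos_of_pos hκ0 _),
      ← Real.rpow_mul (abs_nonneg _)] at h
    have e : p * (1 + 2 / p) = 2 + p := by field_simp; ring
    rw [e] at h
    refine le_trans (le_of_eq ?_) h
    ring
  have hM := Mp_mono (b := b) (c := c) hp1 (((Good.const _).mul (Good.const 1)).add ((Good.const _).mul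
    (Good.rpow 0 hp0.le))) (Good.rpow (n := m+2) 0 (by linarith : (0:ℝ) ≤ 2 + p)) pt
  rw [Mp_add hp1 ((Good.const _).mul (Good.const 1)) ((Good.const _).mul (Good.rpow 0 hp0.le)),
    Mp_cmul, Mp_cmul] at hM
  have hEu : Mp (m+2) 2 b c p (fun x => |x 0| ^ p) = κ * Mp (m+2) 2 b c p (fun _ => 1) := by
    rw [hκ]; field_simp; linarith
  rw [hEu] at hM
  have e2 : A = p * κ := by rw [hκ]; field_simp
  have hM2 := mul_le_mul_of_nonneg_left hM hp0.le
  refine le_trans (le_of_eq ?_) hM2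
  rw [Real.rpow_add hκ0, Real.rpow_one]
  nth_rw 1 [e2]
  field_simp
  ring

lemma J2 (hb : 1 ≤ b) (hp : 2 ≤ p) {K : ℝ} (hK : 0 < K)
    (hK2 : p + 1 + c + b * (p + m * (p + 2)) ≤ K * p) :
    Mp (m+2) 2 b c p (fun x => |x 0| ^ (2 + p) * x 1 ^ 2) ≤
      K ^ (2 / p) * Mp (m+2) 2 b c p (fun x => |x 0| ^ p * x 1 ^ 2) := by
  have hp1 : 1 ≤ p := by linarith
  have hp0 : 0 < p := by linarith
  have h5 := I5 (m := m) (c := c) hb hp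
  have hU : 0 ≤ Mp (m+2) 2 b c p (fun x => |x 0| ^ p * x 1 ^ 2) :=
    Mp_nonneg fun x => mul_nonneg (Real.rpow_nonneg (abs_nonneg _) _) (sq_nonneg _)
  have h6 : Mp (m+2) 2 b c p (fun x => |x 0| ^ (p + p) * x 1 ^ 2) ≤
      K * Mp (m+2) 2 b c p (fun x => |x 0| ^ p * x 1 ^ 2) := by
    have := h5.trans (mul_le_mul_of_nonneg_right hK2 hU)
    rw [mul_comm K p, mul_assoc] at this
    exact le_of_mul_le_mul_left this hp0
  have hθ : 0 ≤ 2 / p := by positivity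
  have hθ1 : 2 / p ≤ 1 := by rw [div_le_one hp0]; exact hp
  have hKθ : 0 < K ^ (2/p) := Real.rpow_pos_of_pos hK _
  have pt : ∀ x : Fin (m+2) → ℝ, |x 0| ^ (2 + p) * x 1 ^ 2 ≤
      (K ^ (2/p) * (1 - 2/p)) * (|x 0| ^ p * x 1 ^ 2) +
      (K ^ (2/p) * (2/p/K)) * (|x 0| ^ (p+p) * x 1 ^ 2) := by
    intro x
    have hv : 0 ≤ |x 0| ^ p := Real.rpow_nonneg (abs_nonneg _) _
    have h := rpow_one_add_le_one_add_mul_self (s := |x 0| ^ p / K - 1)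
      (by have := div_nonneg hv hK.le; linarith) hθ hθ1
    rw [add_sub_cancel, Real.div_rpow hv hK.le, div_le_iff₀ hKθ,
      ← Real.rpow_mul (abs_nonneg _)] at h
    have e : p * (2 / p) = 2 := by field_simp
    rw [e] at h
    have h2 := mul_le_mul_of_nonneg_right h (mul_nonneg hv (sq_nonneg (x 1)))
    rw [Real.rpow_add_of_nonneg (abs_nonneg _) (by norm_num) hp0.le,
      Real.rpow_add_of_nonneg (abs_nonneg _) hp0.le hp0.le]
    refine le_of_eq_of_le ?_ (h2.trans (le_of_eq ?_))
    · ring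
    · ring
  have g1 : Good (fun x : Fin (m+2) → ℝ => |x 0| ^ p * x 1 ^ 2) :=
    (Good.rpow 0 hp0.le).mul ((Good.coord _).pow 2)
  have g2 : Good (fun x : Fin (m+2) → ℝ => |x 0| ^ (p+p) * x 1 ^ 2) :=
    (Good.rpow 0 (by linarith)).mul ((Good.coord _).pow 2)
  have g3 : Good (fun x : Fin (m+2) → ℝ => |x 0| ^ (2+p) * x 1 ^ 2) :=
    (Good.rpow 0 (by linarith)).mul ((Good.coord _).pow 2)
  have hM := Mp_mono (b := b) (c := c) hp1 g3 (((Good.const _).mul g1).add ((Good.const _).mul g2)) pt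
  rw [Mp_add hp1 ((Good.const _).mul g1) ((Good.const _).mul g2), Mp_cmul, Mp_cmul] at hM
  refine hM.trans ?_
  have := mul_le_mul_of_nonneg_left h6 (by positivity : 0 ≤ K ^ (2/p) * (2/p/K))
  refine (add_le_add_right this _).trans (le_of_eq ?_)
  field_simp
  ring

lemma part_i (hb : 1 ≤ b) (hp : 2 ≤ p) {K : ℝ} (hK : 0 < K)
    (hK2 : p + 1 + c + b * (p + m * (p + 2)) ≤ K * p)
    (hS : K ^ (2/p) * ((1 + c + b * m) * (3 + c + 2 * b * (m+1))) ≤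
      ((1 + c + b * (m+1)) / p) ^ (2/p) * ((1 + c + b * (m+1)) * (3 + c + b + 2 * b * m))) :
    Mp (m+2) 2 b c p (fun x => x 0 ^ 2 * x 1 ^ 2) * Mp (m+2) 2 b c p (fun _ => 1) ≤
      Mp (m+2) 2 b c p (fun x => x 0 ^ 2) * Mp (m+2) 2 b c p (fun x => x 1 ^ 2) := by
  have hp1 : 1 ≤ p := by linarith
  have hp0 : 0 < p := by linarith
  have j1 := J1 (m := m) (c := c) hb hp
  have j2 := J2 (m := m) (c := c) hb hp hK hK2
  rw [← I2 hb hp1] at j1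
  have j3 := mul_le_mul_of_nonneg_left j2 hp0.le
  rw [← I4 hb hp1, mul_left_comm, ← I3 hb hp1] at j3
  rw [M_coord 1]
  have hm : 0 ≤ Mp (m+2) 2 b c p (fun x => x 0 ^ 2) := Mp_nonneg fun x => sq_nonneg _
  have h1 : 0 ≤ Mp (m+2) 2 b c p (fun x => 1) := Mp_nonneg fun x => zero_le_one
  generalize Mp (m+2) 2 b c p (fun x => x 0 ^ 2) = M2 at *
  generalize Mp (m+2) 2 b c p (fun x => 1) = M1 at *
  generalize Mp (m+2) 2 b c p (fun x => x 0 ^ 2 * x 1 ^ 2) = Q at *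
  clear j2 hK2
  have hKθ : 0 < K ^ (2/p) := Real.rpow_pos_of_pos hK _
  generalize K ^ (2/p) = k at *
  have hA : (0:ℝ) < 1 + c + b * (m+1) := by positivity
  have hl : 0 < ((1 + c + b * (m+1)) / p : ℝ) ^ (2/p) := Real.rpow_pos_of_pos (by positivity) _
  generalize ((1 + c + b * (m+1)) / p : ℝ) ^ (2/p) = l at *
  have hA' : (0:ℝ) ≤ 1 + c + b * m := by positivity
  have hB : (0:ℝ) < 3 + c + 2 * b * (m+1) := by positivity
  have hB' : (0:ℝ) < 3 + c + b + 2 * b * m := by positivity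
  generalize (1 + c + b * (m+1) : ℝ) = A at *
  generalize (1 + c + b * m : ℝ) = A' at *
  generalize (3 + c + 2 * b * (m+1) : ℝ) = B at *
  generalize (3 + c + b + 2 * b * m : ℝ) = B' at *
  have pos : 0 < A * l * B' := by positivity
  refine le_of_mul_le_mul_left ?_ pos
  calc A * l * B' * (Q * M1) = (B' * Q) * (A * l * M1) := by ring
    _ ≤ (k * (A' * M2)) * (B * M2) := mul_le_mul j3 j1 (by positivity) (by positivity)
    _ = (k * (A' * B)) * (M2 * M2) := by ring
    _ ≤ (l * (A * B')) * (M2 * M2) := mul_le_mul_of_nonneg_right hS (by positivity)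
    _ = _ := by ring

end

set_option maxHeartbeats 2000000 in
/-- The scalar inequality. -/
lemma scalar (b c : ℕ) (hb : 1 ≤ b) : ∃ c₀ : ℝ, 0 < c₀ ∧ ∃ N : ℕ, ∀ m : ℕ, N ≤ m + 2 →
    ∀ p : ℝ, c₀ * ((m + 2 : ℕ) : ℝ) * Real.log ((m + 2 : ℕ) : ℝ) ≤ p → 2 ≤ p ∧ ∃ K : ℝ, 0 < K ∧
    p + 1 + c + b * (p + m * (p + 2)) ≤ K * p ∧
    K ^ (2/p) * ((1 + c + b * m) * (3 + c + 2 * b * (m+1))) ≤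
      ((1 + c + b * (m+1)) / p) ^ (2/p) * ((1 + c + b * (m+1)) * (3 + c + b + 2 * b * m)) := by
  set C : ℝ := 3 + c + 2 * b with hC
  have hb1 : (1:ℝ) ≤ b := by exact_mod_cast hb
  have hc0 : (0:ℝ) ≤ c := c.cast_nonneg
  have hC5 : 5 ≤ C := by linarith
  refine ⟨36 * C ^ 2, by positivity, ⌈36 * C ^ 2⌉₊, ?_⟩
  intro m hm p hp
  set n : ℝ := ((m + 2 : ℕ) : ℝ) with hn
  have hnm : (m:ℝ) = n - 2 := by rw [hn]; push_cast; ring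
  have hnC : 36 * C ^ 2 ≤ n := (Nat.le_ceil _).trans (by rw [hn]; exact_mod_cast hm)
  have hCn : C ≤ n := by nlinarith
  have hn900 : 900 ≤ n := by nlinarith
  have hn0 : 0 < n := by linarith
  have hlog1 : 1 ≤ Real.log n := by
    rw [Real.le_log_iff_exp_le hn0]
    have := Real.exp_one_lt_d9
    linarith
  set p0 : ℝ := 36 * C ^ 2 * n * Real.log n with hp0d
  have hp0n : 36 * C ^ 2 * n ≤ p0 := by
    rw [hp0d]
    exact le_mul_of_one_le_right (by positivity) hlog1
  have hp0n' : n ≤ p0 := (le_mul_of_one_le_left hn0.le (by nlinarith)).trans hp0n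
  have hpn : n ≤ p := hp0n'.trans hp
  have hp2 : 2 ≤ p := by linarith
  have hpp : 0 < p := by linarith
  refine ⟨hp2, C * n, by positivity, ?_, ?_⟩
  · rw [hnm, hC]
    have hbn : (0:ℝ) ≤ b * (n - 2) := mul_nonneg (by linarith) (by linarith)
    nlinarith [mul_nonneg hbn (by linarith : 0 ≤ p - 2), mul_nonneg hc0 (by nlinarith : 0 ≤ n * p - 1),
      mul_nonneg (by linarith : (0:ℝ) ≤ b) hpp.le, mul_pos hn0 hpp]
  have hA : (0:ℝ) < 1 + c + b * (m+1) := by positivity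
  have hB' : (0:ℝ) < 3 + c + b + 2 * b * m := by positivity
  set A : ℝ := 1 + c + b * (m+1) with hAd
  set B' : ℝ := 3 + c + b + 2 * b * m with hBd
  have hA1 : 1 ≤ A := by rw [hAd]; have : (0:ℝ) ≤ b * (m+1) := by positivity
                         linarith
  have step1 : (C * n) ^ (2/p) ≤ (A / p) ^ (2/p) * (p ^ (3:ℝ)) ^ (2/p) := by
    rw [← Real.mul_rpow (by positivity) (by positivity)]
    refine Real.rpow_le_rpow (by positivity) ?_ (by positivity)
    have : A / p * p ^ (3:ℝ) = A * p ^ 2 := by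
      rw [show (3:ℝ) = ((3:ℕ):ℝ) by norm_num, Real.rpow_natCast]; field_simp
    rw [this]
    nlinarith [mul_le_mul (hCn.trans hpn) hpn hn0.le hpp.le, sq_nonneg p]
  have step2 : (p ^ (3:ℝ)) ^ (2/p) ≤ Real.exp (1 / (2 * C ^ 2 * n)) := by
    rw [← Real.rpow_mul hpp.le, Real.rpow_def_of_pos hpp]
    refine Real.exp_le_exp.2 ?_
    have hanti := Real.log_div_self_antitoneOn
    have hexp : Real.exp 1 ≤ p0 := by
      have := Real.exp_one_lt_d9
      linarith
    have h1 := hanti (Set.mem_Ici.2 hexp) (Set.mem_Ici.2 (hexp.trans hp)) hp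
    simp only at h1
    have hp0pos : 0 < p0 := by linarith
    have h2 : Real.log p0 ≤ 3 * Real.log n := by
      have : p0 ≤ n ^ 3 := by
        have hl : Real.log n ≤ n := (Real.log_le_sub_one_of_pos hn0).trans (by linarith)
        calc p0 = (36 * C ^ 2) * (n * Real.log n) := by rw [hp0d]; ring
          _ ≤ n * (n * n) := by gcongr
          _ = n ^ 3 := by ring
      calc Real.log p0 ≤ Real.log (n ^ 3) := Real.log_le_log hp0pos this
        _ = 3 * Real.log n := by rw [Real.log_pow]; norm_num
    have h3 : Real.log p0 / p0 ≤ 3 * Real.log n / p0 := by gcongr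
    have h4 : 3 * Real.log n / p0 = 1 / (12 * C ^ 2 * n) := by
      rw [hp0d]; field_simp; norm_num
    have h5 : Real.log p / p ≤ 1 / (12 * C ^ 2 * n) := h1.trans (h3.trans h4.le)
    calc Real.log p * (3 * (2 / p)) = 6 * (Real.log p / p) := by ring
      _ ≤ 6 * (1 / (12 * C ^ 2 * n)) := by gcongr
      _ = _ := by field_simp; norm_num
  have step3 : Real.exp (1 / (2 * C ^ 2 * n)) * ((1 + c + b * m) * (3 + c + 2 * b * (m+1)))
      ≤ A * B' := by
    have e : ((1 + c + b * m) * (3 + c + 2 * b * (m+1)) : ℝ) = A * B' * (1 - b * (2 + b * (m+1)) / (A * B')) := by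
      field_simp
      rw [hAd, hBd]; ring
    have h1 : 1 / (2 * C ^ 2 * n) ≤ b * (2 + b * (m+1)) / (A * B') := by
      have hAn : A ≤ C * n := by
        rw [hAd, hC, hnm]; nlinarith
      have hBn : B' ≤ C * n := by
        rw [hBd, hC, hnm]; nlinarith
      rw [div_le_div_iff₀ (by positivity) (by positivity)]
      have h2 : A * B' ≤ C * n * (C * n) := by gcongr
      have h3 : n / 2 ≤ b * (2 + b * (m+1)) := by
        have : n / 2 ≤ m + 1 := by rw [hnm]; linarith
        have h4 : (m:ℝ) + 1 ≤ b * (m+1) := le_mul_of_one_le_left (by positivity) hb1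
        have h5 : (2 + b * (m+1) : ℝ) ≤ b * (2 + b * (m+1)) := le_mul_of_one_le_left (by positivity) hb1
        linarith
      calc 1 * (A * B') ≤ C * n * (C * n) := by linarith
        _ = n / 2 * (2 * C ^ 2 * n) := by ring
        _ ≤ _ := by gcongr
    set s : ℝ := b * (2 + b * (m+1)) / (A * B')
    have h6 : 1 - s ≤ Real.exp (-s) := by have := Real.add_one_le_exp (-s); linarith
    rw [e]
    calc Real.exp (1 / (2 * C ^ 2 * n)) * (A * B' * (1 - s))
        ≤ Real.exp (1 / (2 * C ^ 2 * n)) * (A * B' * Real.exp (-s)) := by gcongr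
      _ ≤ Real.exp s * (A * B' * Real.exp (-s)) := by gcongr
      _ = A * B' * (Real.exp s * Real.exp (-s)) := by ring
      _ = A * B' := by rw [← Real.exp_add]; simp
  have hl : 0 ≤ (A / p) ^ (2/p) := Real.rpow_nonneg (by positivity) _
  calc (C * n) ^ (2/p) * ((1 + c + b * m) * (3 + c + 2 * b * (m+1)))
      ≤ ((A / p) ^ (2/p) * Real.exp (1 / (2 * C ^ 2 * n))) *
        ((1 + c + b * m) * (3 + c + 2 * b * (m+1))) := by
        refine mul_le_mul_of_nonneg_right (step1.trans ?_) (by positivity)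
        gcongr
    _ = (A / p) ^ (2/p) * (Real.exp (1 / (2 * C ^ 2 * n)) *
        ((1 + c + b * m) * (3 + c + 2 * b * (m+1)))) := by ring
    _ ≤ _ := by gcongr

end S15
namespace S15

open Filter Topology

lemma fabc_smul (n b c : ℕ) : ∃ D : ℕ, ∀ (t : ℝ), 0 < t → ∀ x : Fin n → ℝ,
    fabc n 2 b c (t • x) = t ^ D * fabc n 2 b c x := by
  refine ⟨(∑ i : Fin n, ∑ j : Fin n, if i < j then 2 * b else 0) + ∑ i : Fin n, c, fun t ht x => ?_⟩
  unfold fabc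
  have h1 : (∏ i : Fin n, ∏ j : Fin n,
        if i < j then |(t • x) i ^ 2 - (t • x) j ^ 2| ^ b else 1) =
      t ^ (∑ i : Fin n, ∑ j : Fin n, if i < j then 2 * b else 0) *
        ∏ i : Fin n, ∏ j : Fin n, if i < j then |x i ^ 2 - x j ^ 2| ^ b else 1 := by
    rw [← Finset.prod_pow_eq_pow_sum, ← Finset.prod_mul_distrib]
    refine Finset.prod_congr rfl fun i _ => ?_
    rw [← Finset.prod_pow_eq_pow_sum, ← Finset.prod_mul_distrib]
    refine Finset.prod_congr rfl fun j _ => ?_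
    split_ifs
    · simp only [Pi.smul_apply, smul_eq_mul]
      rw [pow_mul, ← mul_pow]
      congr 1
      rw [← abs_of_pos (pow_pos ht 2), ← abs_mul]
      congr 1; ring
    · simp
  have h2 : (∏ i : Fin n, |(t • x) i| ^ c) = t ^ (∑ i : Fin n, c) * ∏ i : Fin n, |x i| ^ c := by
    rw [← Finset.prod_pow_eq_pow_sum, ← Finset.prod_mul_distrib]
    refine Finset.prod_congr rfl fun i _ => ?_
    simp only [Pi.smul_apply, smul_eq_mul, abs_mul, abs_of_pos ht, mul_pow]
  rw [h1, h2, pow_add]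
  ring

lemma N_smul {n : ℕ} {p t : ℝ} (hp : 0 < p) (ht : 0 < t) (x : Fin n → ℝ) :
    ∑ i, |(t ^ (1/p) • x) i| ^ p = t * ∑ i, |x i| ^ p := by
  rw [Finset.mul_sum]
  refine Finset.sum_congr rfl fun i _ => ?_
  have h := Real.rpow_pos_of_pos ht (1/p)
  simp only [Pi.smul_apply, smul_eq_mul]
  rw [abs_mul, Real.mul_rpow (abs_nonneg _) (abs_nonneg _), abs_of_pos h, ← Real.rpow_mul ht.le,
    one_div_mul_cancel hp.ne', Real.rpow_one]

lemma meas_N {n : ℕ} (p : ℝ) : Measurable (fun x : Fin n → ℝ => ∑ i, |x i| ^ p) := by fun_prop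

lemma ball_scale {n : ℕ} {p t : ℝ} (hp : 0 < p) (ht : 0 < t) {H : (Fin n → ℝ) → ℝ} {d : ℕ}
    (hd : ∀ (t : ℝ), 0 < t → ∀ x, H (t • x) = t ^ d * H x) :
    ∫ x in {x : Fin n → ℝ | ∑ i, |x i| ^ p ≤ t}, H x =
      t ^ (((n:ℝ) + d) / p) * ∫ x in {x : Fin n → ℝ | ∑ i, |x i| ^ p ≤ 1}, H x := by
  have hR : 0 < t ^ (1/p) := Real.rpow_pos_of_pos ht _
  have ms : ∀ s : ℝ, MeasurableSet {x : Fin n → ℝ | ∑ i, |x i| ^ p ≤ s} := fun s =>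
    measurableSet_le (meas_N p) measurable_const
  rw [← integral_indicator (ms t), ← integral_indicator (ms 1)]
  have h := Measure.integral_comp_smul_of_nonneg (volume : Measure (Fin n → ℝ))
    (({x : Fin n → ℝ | ∑ i, |x i| ^ p ≤ t}).indicator H) (t ^ (1/p)) (hR := hR.le)
  have e : ∀ x, ({x : Fin n → ℝ | ∑ i, |x i| ^ p ≤ t}).indicator H (t ^ (1/p) • x) =
      (t ^ (1/p)) ^ d * ({x : Fin n → ℝ | ∑ i, |x i| ^ p ≤ 1}).indicator H x := by
    intro x
    have iff : (t ^ (1/p) • x) ∈ {x : Fin n → ℝ | ∑ i, |x i| ^ p ≤ t} ↔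
        x ∈ {x : Fin n → ℝ | ∑ i, |x i| ^ p ≤ 1} := by
      change ∑ i, |(t ^ (1/p) • x) i| ^ p ≤ t ↔ ∑ i, |x i| ^ p ≤ 1
      rw [N_smul hp ht]
      constructor
      · intro h; exact le_of_mul_le_mul_left (by linarith) ht
      · intro h; nlinarith
    by_cases hx : x ∈ {x : Fin n → ℝ | ∑ i, |x i| ^ p ≤ 1}
    · rw [Set.indicator_of_mem hx, Set.indicator_of_mem (iff.2 hx), hd _ hR]
    · rw [Set.indicator_of_notMem hx, Set.indicator_of_notMem (fun h => hx (iff.1 h)), mul_zero]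
  simp only [e] at h
  rw [integral_const_mul, Module.finrank_fin_fun, smul_eq_mul] at h
  have e2 : t ^ (((n:ℝ) + d) / p) = (t ^ (1/p)) ^ n * (t ^ (1/p)) ^ d := by
    rw [← pow_add, ← Real.rpow_natCast, ← Real.rpow_mul ht.le]
    congr 1; push_cast; ring
  rw [e2, mul_assoc, h]
  field_simp

lemma gamma_id {n : ℕ} (hn : 0 < n) {p : ℝ} (hp : 1 ≤ p) {H : (Fin n → ℝ) → ℝ} (hH : Good H) {d : ℕ}
    (hd : ∀ (t : ℝ), 0 < t → ∀ x, H (t • x) = t ^ d * H x) :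
    ∫ x, H x * Real.exp (-∑ i, |x i| ^ p) =
      Real.Gamma (((n:ℝ) + d) / p + 1) *
        ∫ x in {x : Fin n → ℝ | ∑ i, |x i| ^ p ≤ 1}, H x := by
  have hp0 : 0 < p := by linarith
  have ms : ∀ s : ℝ, MeasurableSet {x : Fin n → ℝ | ∑ i, |x i| ^ p ≤ s} := fun s =>
    measurableSet_le (meas_N p) measurable_const
  have nn : ∀ x : Fin n → ℝ, 0 ≤ ∑ i, |x i| ^ p := fun x =>
    Finset.sum_nonneg fun i _ => Real.rpow_nonneg (abs_nonneg _) _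
  set f : (Fin n → ℝ) → ℝ → ℝ := fun x t =>
    H x * (Set.Ici (∑ i, |x i| ^ p)).indicator (fun t => Real.exp (-t)) t with hf
  have tI : ∀ a : ℝ, ∫ t, (Set.Ici a).indicator (fun t => Real.exp (-t)) t = Real.exp (-a) := by
    intro a
    rw [integral_indicator measurableSet_Ici, integral_Ici_eq_integral_Ioi, integral_exp_neg_Ioi]
  have tInt : ∀ a : ℝ, Integrable ((Set.Ici a).indicator (fun t => Real.exp (-t))) := by
    intro a
    rw [integrable_indicator_iff measurableSet_Ici]
    exact Iff.mpr integrableOn_Ici_iff_integrableOn_Ioi (integrableOn_exp_neg_Ioi a)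
  have hmeas : Measurable (Function.uncurry f) := by
    have hmH := hH.1
    have : Function.uncurry f = fun z : (Fin n → ℝ) × ℝ => H z.1 *
      ({z : (Fin n → ℝ) × ℝ | ∑ i, |z.1 i| ^ p ≤ z.2}).indicator (fun z => Real.exp (-z.2)) z := by
      funext z
      simp only [hf, Function.uncurry]
      congr 1
    rw [this]
    refine (hmH.comp measurable_fst).mul ?_
    exact Measurable.indicator (by fun_prop)
      (measurableSet_le ((meas_N p).comp measurable_fst) measurable_snd)
  have hint : Integrable (Function.uncurry f) (volume.prod volume) := by
    rw [integrable_prod_iff hmeas.aestronglyMeasurable]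
    refine ⟨Eventually.of_forall fun x => ?_, ?_⟩
    · exact (tInt (∑ i, |x i| ^ p)).const_mul (H x)
    · have : (fun x => ∫ t, ‖Function.uncurry f (x, t)‖) =
          fun x => |H x| * Real.exp (-∑ i, |x i| ^ p) := by
        funext x
        rw [← tI, ← integral_const_mul]
        congr 1; funext t
        simp only [hf, Function.uncurry]
        rw [norm_mul, Real.norm_eq_abs, Real.norm_eq_abs]
        congr 1
        exact abs_of_nonneg (Set.indicator_nonneg (fun _ _ => (Real.exp_pos _).le) _)
      rw [this]
      exact integrable_good hp hH.abs
  have h1 : ∫ x, H x * Real.exp (-∑ i, |x i| ^ p) = ∫ x, ∫ t, f x t := by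
    congr 1; funext x
    rw [← tI, ← integral_const_mul]
  rw [h1, integral_integral_swap hint]
  have h2 : ∀ t, ∫ x, f x t = Real.exp (-t) * ∫ x in {x : Fin n → ℝ | ∑ i, |x i| ^ p ≤ t}, H x := by
    intro t
    rw [← integral_indicator (ms t), ← integral_const_mul]
    congr 1; funext x
    simp only [hf, Set.indicator_apply, Set.mem_Ici, Set.mem_ofPred_eq]
    split_ifs <;> ring
  simp only [h2]
  rw [← setIntegral_eq_integral_of_forall_compl_eq_zero (s := Set.Ici 0), integral_Ici_eq_integral_Ioi]
  · rw [Real.Gamma_eq_integral (by positivity), ← integral_mul_const]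
    refine setIntegral_congr_fun measurableSet_Ioi fun t ht => ?_
    rw [ball_scale hp0 ht hd, add_sub_cancel_right]
    ring
  · intro t ht
    have : {x : Fin n → ℝ | ∑ i, |x i| ^ p ≤ t} = ∅ := by
      ext x
      simp only [Set.mem_ofPred_eq, Set.mem_empty_iff_false, iff_false, not_le]
      simp at ht
      exact ht.trans_le (nn x)
    rw [this]; simp

lemma gamma_sq {x y : ℝ} (hx : 0 < x) (hy : 0 < y) :
    Real.Gamma ((x + y) / 2) * Real.Gamma ((x + y) / 2) ≤ Real.Gamma x * Real.Gamma y := by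
  have h := Real.Gamma_mul_add_mul_le_rpow_Gamma_mul_rpow_Gamma hx hy
    (by norm_num : (0:ℝ) < 1/2) (by norm_num : (0:ℝ) < 1/2) (by norm_num)
  rw [← Real.sqrt_eq_rpow, ← Real.sqrt_eq_rpow, ← Real.sqrt_mul (Real.Gamma_pos_of_pos hx).le,
    show 1/2 * x + 1/2 * y = (x + y) / 2 by ring] at h
  have h0 := Real.Gamma_pos_of_pos (by linarith : 0 < (x + y) / 2)
  calc _ ≤ √(Gamma x * Gamma y) * √(Gamma x * Gamma y) := by gcongr
    _ = _ := Real.mul_self_sqrt (mul_pos (Real.Gamma_pos_of_pos hx) (Real.Gamma_pos_of_pos hy)).le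

lemma MBp_eq {n a b c : ℕ} {p : ℝ} (hp : 0 < p) (g : (Fin n → ℝ) → ℝ) :
    MBp n a b c p g = ∫ x in {x : Fin n → ℝ | ∑ i, |x i| ^ p ≤ 1}, g x * fabc n a b c x := by
  unfold MBp
  congr 2
  ext x
  have nn : 0 ≤ ∑ i, |x i| ^ p :=
    Finset.sum_nonneg fun i _ => Real.rpow_nonneg (abs_nonneg _) _
  simp only [Set.mem_ofPred_eq]
  have h := Real.rpow_le_rpow_iff nn zero_le_one (by positivity : 0 < 1/p)
  rwa [Real.one_rpow] at h

lemma MBp_nonneg {n b c : ℕ} {p : ℝ} {g : (Fin n → ℝ) → ℝ} (h : ∀ x, 0 ≤ g x) :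
    0 ≤ MBp n 2 b c p g :=
  integral_nonneg fun x => mul_nonneg (h x) (fabc_nonneg _ _ _ _)

lemma part_ii {m b c : ℕ} {p : ℝ} (hp : 1 ≤ p)
    (h : Mp (m+2) 2 b c p (fun x => x 0 ^ 2 * x 1 ^ 2) * Mp (m+2) 2 b c p (fun _ => 1) ≤
      Mp (m+2) 2 b c p (fun x => x 0 ^ 2) * Mp (m+2) 2 b c p (fun x => x 1 ^ 2)) :
    MBp (m+2) 2 b c p (fun x => x 0 ^ 2 * x 1 ^ 2) * MBp (m+2) 2 b c p (fun _ => 1) ≤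
      MBp (m+2) 2 b c p (fun x => x 0 ^ 2) * MBp (m+2) 2 b c p (fun x => x 1 ^ 2) := by
  have hp0 : 0 < p := by linarith
  obtain ⟨D, hD⟩ := fabc_smul (m+2) b c
  have key : ∀ (g : (Fin (m+2) → ℝ) → ℝ) (k : ℕ), Good g →
      (∀ t : ℝ, 0 < t → ∀ x, g (t • x) = t ^ k * g x) →
      Mp (m+2) 2 b c p g = Real.Gamma ((((m+2:ℕ):ℝ) + (k + D : ℕ)) / p + 1) *
        MBp (m+2) 2 b c p g := by
    intro g k hg hk
    rw [MBp_eq hp0]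
    refine gamma_id (by omega) hp (hg.mul (Good.fabc _ b c)) fun t ht x => ?_
    rw [hk t ht, hD t ht]; ring
  rw [key _ 4 (((Good.coord _).pow 2).mul ((Good.coord _).pow 2)) (fun t _ x => by simp; ring),
    key _ 0 (Good.const 1) (fun t _ x => by simp),
    key _ 2 ((Good.coord _).pow 2) (fun t _ x => by simp; ring),
    key _ 2 ((Good.coord _).pow 2) (fun t _ x => by simp; ring)] at h
  set G4 := Real.Gamma ((((m+2:ℕ):ℝ) + (4 + D : ℕ)) / p + 1)
  set G2 := Real.Gamma ((((m+2:ℕ):ℝ) + (2 + D : ℕ)) / p + 1) with hG2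
  set G0 := Real.Gamma ((((m+2:ℕ):ℝ) + (0 + D : ℕ)) / p + 1)
  have p4 : 0 < G4 := Real.Gamma_pos_of_pos (by positivity)
  have p0 : 0 < G0 := Real.Gamma_pos_of_pos (by positivity)
  have hG : G2 * G2 ≤ G4 * G0 := by
    have := gamma_sq (x := (((m+2:ℕ):ℝ) + (4 + D : ℕ)) / p + 1)
      (y := (((m+2:ℕ):ℝ) + (0 + D : ℕ)) / p + 1) (by positivity) (by positivity)
    convert this using 3 <;> (push_cast; ring)
  have n1 : 0 ≤ MBp (m+2) 2 b c p (fun x => x 0 ^ 2) := MBp_nonneg fun x => sq_nonneg _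
  have n2 : 0 ≤ MBp (m+2) 2 b c p (fun x => x 1 ^ 2) := MBp_nonneg fun x => sq_nonneg _
  refine le_of_mul_le_mul_left ?_ (mul_pos p4 p0)
  have := mul_le_mul_of_nonneg_right hG (mul_nonneg n1 n2)
  linarith

lemma tendsto_MB {n b c : ℕ} {g : (Fin n → ℝ) → ℝ} (hg : Continuous g) :
    Tendsto (fun p : ℝ => MBp n 2 b c p g) atTop (𝓝 (MBinf n 2 b c g)) := by
  have ms : ∀ p s : ℝ, MeasurableSet {x : Fin n → ℝ | ∑ i, |x i| ^ p ≤ s} := fun p s =>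
    measurableSet_le (meas_N p) measurable_const
  have hcube : {x : Fin n → ℝ | ∀ i, |x i| ≤ 1} = Set.Icc (fun _ => -1) (fun _ => 1) := by
    ext x
    simp only [Set.mem_ofPred_eq, Set.mem_Icc, Pi.le_def, abs_le]
    exact forall_and
  have hH : Continuous (fun x => g x * fabc n 2 b c x) := hg.mul (continuous_fabc n b c)
  unfold MBinf
  rw [hcube, ← integral_indicator measurableSet_Icc]
  have e : (fun p : ℝ => MBp n 2 b c p g) =ᶠ[atTop] fun p : ℝ =>
      ∫ x, ({x : Fin n → ℝ | ∑ i, |x i| ^ p ≤ 1}).indicator (fun x => g x * fabc n 2 b c x) x := by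
    filter_upwards [eventually_gt_atTop 0] with p hp
    rw [MBp_eq hp, integral_indicator (ms p 1)]
  refine Tendsto.congr' e.symm ?_
  have hsub : ∀ p : ℝ, 0 < p → {x : Fin n → ℝ | ∑ i, |x i| ^ p ≤ 1} ⊆
      Set.Icc (fun _ => -1) (fun _ => 1) := by
    intro p hp x hx
    rw [← hcube]
    intro i
    have h1 : |x i| ^ p ≤ ∑ i, |x i| ^ p :=
      Finset.single_le_sum (f := fun i => |x i| ^ p)
        (fun i _ => Real.rpow_nonneg (abs_nonneg _) _) (Finset.mem_univ i)
    by_contra hc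
    have := Real.one_lt_rpow (not_le.1 hc) hp
    have hx : ∑ i, |x i| ^ p ≤ 1 := hx
    linarith
  refine tendsto_integral_filter_of_dominated_convergence
    ((Set.Icc (fun _ => -1) (fun _ => 1)).indicator (fun x => ‖g x * fabc n 2 b c x‖)) ?_ ?_ ?_ ?_
  · exact Eventually.of_forall fun p => (hH.measurable.indicator (ms p 1)).aestronglyMeasurable
  · filter_upwards [eventually_gt_atTop 0] with p hp
    refine Eventually.of_forall fun x => ?_
    rw [norm_indicator_eq_indicator_norm]
    exact Set.indicator_le_indicator_of_subset (hsub p hp) (fun _ => norm_nonneg _) x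
  · rw [integrable_indicator_iff measurableSet_Icc]
    exact (hH.norm.continuousOn).integrableOn_compact isCompact_Icc
  · have hae := Measure.univ_pi_Ioo_ae_eq_Icc (μ := fun _ : Fin n => (volume : Measure ℝ))
      (f := fun _ => -1) (g := fun _ => 1)
    filter_upwards [hae] with x hx
    refine tendsto_const_nhds.congr' ?_
    by_cases hx1 : x ∈ Set.Icc (fun _ => (-1:ℝ)) (fun _ => 1)
    · have hx2 : x ∈ Set.univ.pi fun _ : Fin n => Set.Ioo (-1:ℝ) 1 := hx.mpr hx1
      have ht : Tendsto (fun p : ℝ => ∑ i, |x i| ^ p) atTop (𝓝 (∑ i : Fin n, 0)) := by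
        refine tendsto_finsetSum _ fun i _ => ?_
        have := hx2 i (Set.mem_univ i)
        exact tendsto_rpow_atTop_of_base_lt_one _ (by linarith [abs_nonneg (x i)])
          (abs_lt.2 this)
      rw [Finset.sum_const_zero] at ht
      filter_upwards [ht.eventually (eventually_le_nhds zero_lt_one)] with p hp
      have hp' : x ∈ {x : Fin n → ℝ | ∑ i, |x i| ^ p ≤ 1} := hp
      rw [Set.indicator_of_mem hx1, Set.indicator_of_mem hp']
    · filter_upwards [eventually_gt_atTop 0] with p hp
      rw [Set.indicator_of_notMem hx1, Set.indicator_of_notMem (fun h => hx1 (hsub p hp h))]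

end S15

/-- negative correlation property, Corollary 5 of the paper. -/
theorem statement15 (b c : ℕ) (hb : 1 ≤ b) :
    ∃ c₀ : ℝ, 0 < c₀ ∧ ∃ N : ℕ,
      ∀ (n : ℕ) (hN : N ≤ n) (hn : 2 ≤ n),
        (∀ p : ℝ, c₀ * n * Real.log n ≤ p →
          Mp n 2 b c p (fun x => x ⟨0, by omega⟩ ^ 2 * x ⟨1, by omega⟩ ^ 2) *
              Mp n 2 b c p (fun _ => 1) ≤
            Mp n 2 b c p (fun x => x ⟨0, by omega⟩ ^ 2) *
              Mp n 2 b c p (fun x => x ⟨1, by omega⟩ ^ 2)) ∧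
        (∀ p : ℝ, c₀ * n * Real.log n ≤ p →
          MBp n 2 b c p (fun x => x ⟨0, by omega⟩ ^ 2 * x ⟨1, by omega⟩ ^ 2) *
              MBp n 2 b c p (fun _ => 1) ≤
            MBp n 2 b c p (fun x => x ⟨0, by omega⟩ ^ 2) *
              MBp n 2 b c p (fun x => x ⟨1, by omega⟩ ^ 2)) ∧
        (MBinf n 2 b c (fun x => x ⟨0, by omega⟩ ^ 2 * x ⟨1, by omega⟩ ^ 2) *
              MBinf n 2 b c (fun _ => 1) ≤
            MBinf n 2 b c (fun x => x ⟨0, by omega⟩ ^ 2) *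
              MBinf n 2 b c (fun x => x ⟨1, by omega⟩ ^ 2)) := by
  obtain ⟨c₀, hc₀, N, hN⟩ := S15.scalar b c hb
  refine ⟨c₀, hc₀, N, ?_⟩
  intro n hNn hn
  obtain ⟨m, rfl⟩ : ∃ m, n = m + 2 := ⟨n - 2, by omega⟩
  have hi : ∀ p : ℝ, c₀ * ((m + 2 : ℕ) : ℝ) * Real.log ((m + 2 : ℕ) : ℝ) ≤ p →
      1 ≤ p ∧ Mp (m+2) 2 b c p (fun x => x 0 ^ 2 * x 1 ^ 2) * Mp (m+2) 2 b c p (fun _ => 1) ≤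
      Mp (m+2) 2 b c p (fun x => x 0 ^ 2) * Mp (m+2) 2 b c p (fun x => x 1 ^ 2) := by
    intro p hp
    obtain ⟨hp2, K, hK, hK2, hS⟩ := hN m hNn p hp
    exact ⟨by linarith, S15.part_i hb hp2 hK hK2 hS⟩
  have hii := fun p hp => S15.part_ii (hi p hp).1 (hi p hp).2
  refine ⟨fun p hp => (hi p hp).2, hii, ?_⟩
  have t1 := S15.tendsto_MB (n := m+2) (b := b) (c := c)
    (g := fun x => x 0 ^ 2 * x 1 ^ 2) (by fun_prop)
  have t2 := S15.tendsto_MB (n := m+2) (b := b) (c := c) (g := fun _ => 1) (by fun_prop)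
  have t3 := S15.tendsto_MB (n := m+2) (b := b) (c := c) (g := fun x => x 0 ^ 2) (by fun_prop)
  have t4 := S15.tendsto_MB (n := m+2) (b := b) (c := c) (g := fun x => x 1 ^ 2) (by fun_prop)
  exact le_of_tendsto_of_tendsto (t1.mul t2) (t3.mul t4)
    ((Filter.eventually_ge_atTop _).mono hii)
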